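/- arXiv:2212.01522 — 2 statements merged into one kernel-verified Lean document; each statement's English description precedes it below -/
import Mathlib

section
/- Consider case (a). Let r > 0, d₁, q₁ > 0, and let u* ≫ 0 satisfy Σ_{j=1}^n (d₁D_{ij} + q₁Q_{ij})u*_j + u*_i(r − u*_i) = 0 for all i. Let d₂, q₂ > 0 and let u, v : [0,∞) → ℝⁿ be differentiable functions satisfying, for all t ≥ 0 and all i: u′ᵢ(t) = Σ_{j=1}^n (d₁D_{ij} + q₁Q_{ij})u_j(t) + u_i(t)(r − u_i(t) − v_i(t)) and v′ᵢ(t) = Σ_{j=1}^n (d₂D_{ij} + q₂Q_{ij})v_j(t) + v_i(t)(r − u_i(t) − v_i(t)), with u(0) ≥ 0 and v(0) ≥ 0 componentwise. (i) Fix q₂ = q₁: if 0 < d₂ < d₁ and u(0) ≠ 0, then u(t) → u* and v(t) → 0 as t → ∞; if d₂ > d₁ and v(0) ≠ 0, then there is a unique v* ≫ 0 with Σ_j (d₂D_{ij} + q₂Q_{ij})v*_j + v*_i(r − v*_i) = 0 for all i, and u(t) → 0, v(t) → v* as t → ∞. (ii) Fix d₂ = d₁: if q₂ > q₁ and u(0)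 ≠ 0, then u(t) → u* and v(t) → 0; if 0 < q₂ < q₁ and v(0) ≠ 0, then the unique v* ≫ 0 as above exists and u(t) → 0, v(t) → v*. (The species with larger diffusion rate or smaller advection rate excludes the other.) -/
open Matrix Filter

/-- Case (a) diffusion matrix (hypothesis H1, stream-to-lake). -/
def Da (n : ℕ) : Matrix (Fin n) (Fin n) ℝ := fun i j =>
  if (i : ℕ) + 1 = (j : ℕ) ∨ (j : ℕ) + 1 = (i : ℕ) then 1
  else if i = j then (if (i : ℕ) = 0 ∨ (i : ℕ) = n - 1 then -1 else -2)
  else 0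

/-- Case (b) diffusion matrix (hypothesis H1*, stream-to-ocean). -/
def Db (n : ℕ) : Matrix (Fin n) (Fin n) ℝ := fun i j =>
  if (i : ℕ) + 1 = (j : ℕ) ∨ (j : ℕ) + 1 = (i : ℕ) then 1
  else if i = j then (if (i : ℕ) = 0 then -1 else -2)
  else 0

/-- Advection (drift) matrix Q. -/
def Qm (n : ℕ) : Matrix (Fin n) (Fin n) ℝ := fun i j =>
  if (j : ℕ) + 1 = (i : ℕ) then 1 else if i = j then -1 else 0

section LVcore
open Topology Matrix Filter

variable {ι : Type} [Fintype ι]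

def Met (A : ι → ι → ℝ) : Prop := ∀ i j, i ≠ j → 0 ≤ A i j
def Irr (A : ι → ι → ℝ) : Prop := ∀ P : ι → Prop, (∃ i, P i) →
  (∀ i j, i ≠ j → P j → 0 < A i j → P i) → ∀ i, P i
def RowS (A : ι → ι → ℝ) : Prop := ∀ i, ∑ j, A i j ≤ 0

lemma exists_unif_pos (f : ι → ℝ) (hf : ∀ i, 0 < f i) : ∃ e > 0, ∀ i, e ≤ f i := by
  rcases isEmpty_or_nonempty ι with h | h
  · exact ⟨1, one_pos, fun i => (h.false i).elim⟩
  · obtain ⟨i, hi⟩ := Finite.exists_min f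
    exact ⟨f i, hf i, hi⟩

lemma Met.sum_le {A : ι → ι → ℝ} (hA : Met A) {x y : ι → ℝ} (h : ∀ j, x j ≤ y j) {i : ι}
    (hi : x i = y i) : ∑ j, A i j * x j ≤ ∑ j, A i j * y j := by
  apply Finset.sum_le_sum
  intro j _
  by_cases hj : i = j
  · subst hj; rw [hi]
  · exact mul_le_mul_of_nonneg_left (h j) (hA i j hj)

/-- a zero of a nonnegative vector where the row sum is nonpositive spreads -/
lemma Irr.pos {A : ι → ι → ℝ} (hA : Met A) (hI : Irr A) {x : ι → ℝ} (h : ∀ j, 0 ≤ x j)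
    (hne : ∃ i, 0 < x i) (h0 : ∀ i, x i = 0 → ∑ j, A i j * x j ≤ 0) : ∀ i, 0 < x i := by
  apply hI (fun i => 0 < x i) hne
  intro i j hij hj hpos
  by_contra hcon
  have hxi : x i = 0 := le_antisymm (not_lt.1 hcon) (h i)
  have h1 : A i j * x j ≤ ∑ k, A i k * x k := by
    apply Finset.single_le_sum (f := fun k => A i k * x k) _ (Finset.mem_univ j)
    intro k _
    by_cases hk : i = k
    · subst hk; simp [hxi]
    · exact mul_nonneg (hA i k hk) (h k)
  have := h0 i hxi
  have := mul_pos hpos hj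
  linarith

lemma barrier (z z' : ℝ → ι → ℝ) (T T1 : ℝ)
    (hz : ∀ i, ∀ t, T ≤ t → t ≤ T1 → HasDerivAt (fun s => z s i) (z' t i) t)
    (h : ∀ t, T ≤ t → t ≤ T1 → (∀ j, 0 ≤ z t j) → ∀ i, z t i = 0 → 0 < z' t i)
    (h0 : ∀ i, 0 < z T i) : ∀ t, T ≤ t → t ≤ T1 → ∀ i, 0 < z t i := by
  intro t1 ht1 ht1' i1
  by_contra hcon
  push Not at hcon
  have hclosed : ∀ i, IsClosed (Set.Icc T t1 ∩ (fun s => z s i) ⁻¹' Set.Iic 0) := by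
    intro i
    apply ContinuousOn.preimage_isClosed_of_isClosed _ isClosed_Icc isClosed_Iic
    intro t ht
    exact (hz i t ht.1 (ht.2.trans ht1')).continuousAt.continuousWithinAt
  have hS : IsCompact (⋃ i, (Set.Icc T t1 ∩ (fun s => z s i) ⁻¹' Set.Iic 0)) :=
    isCompact_iUnion fun i => isCompact_Icc.of_isClosed_subset (hclosed i) Set.inter_subset_left
  obtain ⟨t0, ht0, hleast⟩ := hS.exists_isLeast
    ⟨t1, Set.mem_iUnion.2 ⟨i1, ⟨ht1, le_rfl⟩, hcon⟩⟩
  obtain ⟨i, ⟨hT, ht01⟩, hi⟩ := Set.mem_iUnion.1 ht0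
  simp only [Set.mem_preimage, Set.mem_Iic] at hi
  have hTlt : T < t0 := by
    rcases hT.lt_or_eq with h' | h'
    · exact h'
    · subst h'; exact absurd (h0 i) (not_lt.2 hi)
  have hbefore : ∀ t, T ≤ t → t < t0 → ∀ j, 0 < z t j := by
    intro t h1 h2 j
    by_contra hc
    have := hleast (Set.mem_iUnion.2 ⟨j, ⟨h1, h2.le.trans ht01⟩, not_lt.1 hc⟩)
    linarith
  have hev : ∀ᶠ t in 𝓝[<] t0, T ≤ t ∧ t < t0 := by
    filter_upwards [Ioo_mem_nhdsLT hTlt] with t ht using ⟨ht.1.le, ht.2⟩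
  have hnn : ∀ j, 0 ≤ z t0 j := by
    intro j
    have hc := (hz j t0 hT (ht01.trans ht1')).continuousAt
    refine ge_of_tendsto (hc.tendsto.mono_left nhdsWithin_le_nhds : Tendsto _ (𝓝[<] t0) _) ?_
    filter_upwards [hev] with t ht using (hbefore t ht.1 ht.2 j).le
  have hzi : z t0 i = 0 := le_antisymm hi (hnn i)
  have hpos := h t0 hT (ht01.trans ht1') hnn i hzi
  have hd := hz i t0 hT (ht01.trans ht1')
  have hs := (hasDerivAt_iff_tendsto_slope.1 hd).mono_left
    (nhdsWithin_mono t0 (fun x (hx : x < t0) => ne_of_lt hx) : 𝓝[<] t0 ≤ 𝓝[≠] t0)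
  have h3 := hs.eventually (lt_mem_nhds hpos)
  obtain ⟨t, ht, htT, htt⟩ := (h3.and hev).exists
  have := hbefore t htT htt i
  rw [slope_def_field, hzi] at ht
  have : (z t i - 0) / (t - t0) < 0 := div_neg_of_pos_of_neg (by linarith) (by linarith)
  have h5 : (0 - z t i) / (t0 - t) = (z t i - 0) / (t - t0) := by
    rw [← neg_sub (z t i) 0, ← neg_sub t t0, neg_div_neg_eq]
  linarith

lemma exists_bound (g : ℝ → ι → ℝ) (hg : ∀ i, ∀ t, 0 ≤ t → ContinuousAt (fun s => g s i) t)
    (t1 : ℝ) : ∃ C, ∀ i, ∀ t, 0 ≤ t → t ≤ t1 → |g t i| < C := by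
  have : ∀ i, ∃ C, ∀ t, 0 ≤ t → t ≤ t1 → |g t i| ≤ C := by
    intro i
    obtain ⟨C, hC⟩ := isCompact_Icc.exists_bound_of_continuousOn (s := Set.Icc 0 t1)
      (f := fun s => g s i) (fun t ht => (hg i t ht.1).continuousWithinAt)
    exact ⟨C, fun t h1 h2 => hC t ⟨h1, h2⟩⟩
  choose C hC using this
  refine ⟨∑ i, |C i| + 1, fun i t h1 h2 => ?_⟩
  have h3 := hC i t h1 h2
  have h4 : |C i| ≤ ∑ i, |C i| :=
    Finset.single_le_sum (f := fun i => |C i|) (fun _ _ => abs_nonneg _) (Finset.mem_univ i)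
  have := le_abs_self (C i)
  linarith

lemma sol_nonneg {A : ι → ι → ℝ} (hA : Met A) (g u : ℝ → ι → ℝ)
    (hg : ∀ i, ∀ t, 0 ≤ t → ContinuousAt (fun s => g s i) t)
    (hu : ∀ i, ∀ t : ℝ, 0 ≤ t → HasDerivAt (fun s => u s i)
      ((∑ j, A i j * u t j) + u t i * g t i) t)
    (h0 : ∀ i, 0 ≤ u 0 i) : ∀ t, 0 ≤ t → ∀ i, 0 ≤ u t i := by
  intro t1 ht1 i1
  obtain ⟨C, hC⟩ := exists_bound (fun t i => (∑ j, A i j) + g t i)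
    (fun i t ht => continuousAt_const.add (hg i t ht)) t1
  by_contra hcon
  push Not at hcon
  set e := - u t1 i1 * Real.exp (-(C * t1)) with he
  have hepos : 0 < e := mul_pos (by linarith) (Real.exp_pos _)
  have key := barrier (fun t i => u t i + e * Real.exp (C * t))
    (fun t i => ((∑ j, A i j * u t j) + u t i * g t i) + e * (Real.exp (C * t) * C)) 0 t1
    (by
      intro i t h1 h2
      refine (hu i t h1).add ?_
      have : HasDerivAt (fun s : ℝ => C * s) C t := by
        simpa using (hasDerivAt_id t).const_mul C
      exact (this.exp).const_mul e)
    (by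
      intro t h1 h2 hz i hi
      have h3 := hA.sum_le (x := fun j => -(e * Real.exp (C * t))) (y := fun j => u t j) (i := i)
        (fun j => by have := hz j; linarith) (by linarith)
      have h4 := (abs_lt.1 (hC i t h1 h2)).2
      simp only [← Finset.sum_mul] at h3
      have h5 : u t i = -(e * Real.exp (C * t)) := by linarith
      have h6 : 0 < e * Real.exp (C * t) := mul_pos hepos (Real.exp_pos _)
      rw [h5]
      nlinarith)
    (by intro i; have := h0 i; simp; linarith)
    t1 ht1 le_rfl i1
  simp only [he, mul_assoc] at key
  rw [← Real.exp_add] at key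
  simp at key

lemma sol_pos {A : ι → ι → ℝ} (hA : Met A) (hI : Irr A) (g u : ℝ → ι → ℝ)
    (hg : ∀ i, ∀ t, 0 ≤ t → ContinuousAt (fun s => g s i) t)
    (hu : ∀ i, ∀ t : ℝ, 0 ≤ t → HasDerivAt (fun s => u s i)
      ((∑ j, A i j * u t j) + u t i * g t i) t)
    (h0 : ∀ i, 0 ≤ u 0 i) (hne : u 0 ≠ 0) : ∀ t, 0 < t → ∀ i, 0 < u t i := by
  intro t0 ht0
  have hnn := sol_nonneg hA g u hg hu h0
  apply hI.pos hA (hnn t0 ht0.le)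
  · by_contra hcon
    push Not at hcon
    apply hne
    funext i
    have hz : u t0 i = 0 := le_antisymm (hcon i) (hnn t0 ht0.le i)
    obtain ⟨C, hC⟩ := exists_bound (fun t i => A i i + g t i)
      (fun i t ht => continuousAt_const.add (hg i t ht)) t0
    have hd : ∀ t, 0 ≤ t → HasDerivAt (fun s => u s i * Real.exp (C * s))
        (((∑ j, A i j * u t j) + u t i * g t i) * Real.exp (C * t)
          + u t i * (Real.exp (C * t) * C)) t := by
      intro t ht
      refine (hu i t ht).mul ?_
      have : HasDerivAt (fun s : ℝ => C * s) C t := by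
        simpa using (hasDerivAt_id t).const_mul C
      exact this.exp
    have hmono : MonotoneOn (fun s => u s i * Real.exp (C * s)) (Set.Icc 0 t0) := by
      apply monotoneOn_of_deriv_nonneg (convex_Icc _ _)
      · intro t ht; exact (hd t ht.1).continuousAt.continuousWithinAt
      · intro t ht; rw [interior_Icc] at ht
        exact (hd t ht.1.le).differentiableAt.differentiableWithinAt
      · intro t ht; rw [interior_Icc] at ht
        rw [(hd t ht.1.le).deriv]
        have h1 : A i i * u t i ≤ ∑ k, A i k * u t k := by
          classical
          have := hA.sum_le (i := i) (x := fun k => if k = i then u t i else 0) (y := u t)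
            (by intro j; split_ifs with h <;> [rw [h]; exact hnn t ht.1.le j]) (by simp)
          simpa using this
        have h2 := (abs_lt.1 (hC i t ht.1.le ht.2.le)).1
        have h3 := hnn t ht.1.le i
        have h4 := Real.exp_pos (C * t)
        have : 0 ≤ (∑ j, A i j * u t j) + u t i * g t i + u t i * C := by nlinarith
        nlinarith
    have := hmono ⟨le_rfl, ht0.le⟩ ⟨ht0.le, le_rfl⟩ ht0.le
    simp [hz] at this
    exact le_antisymm this (h0 i)
  · intro i hi
    have hd := hu i t0 ht0.le
    have hmin : IsLocalMin (fun s => u s i) t0 := by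
      filter_upwards [lt_mem_nhds ht0] with s hs
      rw [hi]; exact hnn s (le_of_lt hs) i
    have := hmin.hasDerivAt_eq_zero hd
    rw [hi] at this
    linarith

lemma qm_exists {κ : Type} [Fintype κ] (f : (κ → ℝ) → κ → ℝ) (hf : Continuous f) (a b : κ → ℝ)
    (hab : a ≤ b)
    (hq : ∀ x y, a ≤ x → x ≤ y → y ≤ b → ∀ i, x i = y i → f x i ≤ f y i)
    (ha : ∀ i, 0 ≤ f a i) (hb : ∀ i, f b i ≤ 0) :
    ∃ x, a ≤ x ∧ x ≤ b ∧ ∀ i, f x i = 0 := by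
  classical
  have hcl : IsClosed {x : κ → ℝ | ∀ i, 0 ≤ f x i} := by
    simp only [Set.ofPred_forall]
    exact isClosed_iInter fun i => isClosed_le continuous_const ((continuous_apply i).comp hf)
  have hK : IsCompact (Set.Icc a b ∩ {x : κ → ℝ | ∀ i, 0 ≤ f x i}) :=
    isCompact_Icc.inter_right hcl
  obtain ⟨x, ⟨⟨hax, hxb⟩, hx⟩, hmax⟩ := hK.exists_isMaxOn ⟨a, ⟨le_rfl, hab⟩, ha⟩
    (f := fun x : κ → ℝ => ∑ i, x i) (by fun_prop)
  refine ⟨x, hax, hxb, fun i => le_antisymm ?_ (hx i)⟩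
  by_contra hcon
  push Not at hcon
  have hxi : x i < b i := by
    rcases (hxb i).lt_or_eq with h | h
    · exact h
    · have := hq x b hax hxb le_rfl i h
      have := hb i
      linarith
  have hc : Continuous (fun e : ℝ => f (Function.update x i e) i) :=
    (continuous_apply i).comp (hf.comp (continuous_const.update i continuous_id))
  have h1 : ∀ᶠ e in 𝓝[>] (x i), 0 < f (Function.update x i e) i := by
    apply nhdsWithin_le_nhds
    apply hc.continuousAt.eventually (lt_mem_nhds _)
    simpa using hcon
  have h2 : ∀ᶠ e in 𝓝[>] (x i), e ∈ Set.Ioo (x i) (b i) := Ioo_mem_nhdsGT hxi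
  obtain ⟨e, he, he1, he2⟩ := (h1.and h2).exists
  have hxy : x ≤ Function.update x i e := by
    intro j
    by_cases hj : j = i
    · subst hj; simpa using he1.le
    · simp [hj]
  have hyb : Function.update x i e ≤ b := by
    intro j
    by_cases hj : j = i
    · subst hj; simpa using he2.le
    · simpa [hj] using hxb j
  have hmem : Function.update x i e ∈ Set.Icc a b ∩ {x : κ → ℝ | ∀ i, 0 ≤ f x i} := by
    refine ⟨⟨hax.trans hxy, hyb⟩, fun j => ?_⟩
    by_cases hj : j = i
    · subst hj; exact he.le
    · exact (hx j).trans (hq x _ hax hxy hyb j (by simp [hj]))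
  have h3 : ∑ j, Function.update x i e j ≤ ∑ j, x j := hmax hmem
  have h4 : ∑ j, x j < ∑ j, Function.update x i e j :=
    Finset.sum_lt_sum (fun j _ => hxy j) ⟨i, Finset.mem_univ i, by simpa using he1⟩
  linarith

lemma star_exists {A : ι → ι → ℝ} (hA : Met A) (hI : Irr A) (hR : RowS A) (r : ℝ)
    (V : ι → ℝ) (hV : ∀ i, 0 ≤ V i) (hne : ∃ i, 0 < V i)
    (hs : ∀ i, 0 ≤ (∑ j, A i j * V j) + V i * (r - V i)) :
    ∃ s : ι → ℝ, (∀ i, 0 < s i) ∧ (∀ i, V i ≤ s i) ∧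
      ∀ i, (∑ j, A i j * s j) + s i * (r - s i) = 0 := by
  set K := |r| + ∑ i, V i with hK
  have hVK : ∀ i, V i ≤ K := fun i => by
    have := Finset.single_le_sum (f := V) (fun j _ => hV j) (Finset.mem_univ i)
    have := abs_nonneg r
    linarith
  have hrK : r ≤ K := by
    have := Finset.sum_nonneg (s := Finset.univ) (fun j _ => hV j)
    have := le_abs_self r
    linarith
  have hK0 : 0 ≤ K := by obtain ⟨i, hi⟩ := hne; exact hi.le.trans (hVK i)
  obtain ⟨s, h1, h2, h3⟩ := qm_exists (fun x i => (∑ j, A i j * x j) + x i * (r - x i))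
    (by fun_prop) V (fun _ => K) hVK
    (by
      intro x y _ hxy _ i hi
      have := hA.sum_le hxy hi
      simp only [hi]; linarith)
    hs
    (by
      intro i
      simp only [← Finset.sum_mul]
      have := hR i
      nlinarith)
  refine ⟨s, ?_, h1, h3⟩
  apply hI.pos hA (fun j => (hV j).trans (h1 j))
  · obtain ⟨i, hi⟩ := hne; exact ⟨i, hi.trans_le (h1 i)⟩
  · intro i hi
    have := h3 i
    simp only [hi] at this
    linarith

lemma sub_le_super {A : ι → ι → ℝ} (hA : Met A) (r : ℝ) (x y : ι → ℝ)
    (hx : ∀ i, 0 < x i)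
    (hsup : ∀ i, (∑ j, A i j * x j) + x i * (r - x i) ≤ 0)
    (hsub : ∀ i, 0 ≤ (∑ j, A i j * y j) + y i * (r - y i)) : ∀ i, y i ≤ x i := by
  intro i0
  have : Nonempty ι := ⟨i0⟩
  obtain ⟨i, hi⟩ := Finite.exists_max (fun i => y i / x i)
  set c := y i / x i with hc
  have hyc : ∀ j, y j ≤ c * x j := fun j => (div_le_iff₀ (hx j)).1 (hi j)
  have hyi : y i = c * x i := by rw [hc, div_mul_cancel₀ _ (hx i).ne']
  by_cases h1 : c ≤ 1
  · exact (hyc i0).trans (by have := hx i0; nlinarith)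
  · exfalso
    push Not at h1
    have h2 := hA.sum_le (x := y) (y := fun j => c * x j) hyc hyi
    have h3 : ∑ j, A i j * (c * x j) = c * ∑ j, A i j * x j := by
      rw [Finset.mul_sum]; congr 1; ext j; ring
    rw [h3] at h2
    have h4 := hsub i
    rw [hyi] at h4
    have h5 := mul_le_mul_of_nonneg_left (hsup i) (by linarith : 0 ≤ c)
    have h6 : 0 < c * (c - 1) * (x i * x i) :=
      mul_pos (mul_pos (by linarith) (by linarith)) (mul_pos (hx i) (hx i))
    nlinarith

lemma perron [Nonempty ι] (B : ι → ι → ℝ) (hA : Met B) (hI : Irr B) :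
    ∃ (φ : ι → ℝ) (l : ℝ), (∀ i, 0 < φ i) ∧ ∀ i, ∑ j, B i j * φ j = l * φ i := by
  classical
  set c := ∑ i, ∑ j, |B i j| + 1 with hc
  have hBc : ∀ i j, |B i j| ≤ c - 1 := by
    intro i j
    have h1 := Finset.single_le_sum (f := fun j => |B i j|) (fun _ _ => abs_nonneg _)
      (Finset.mem_univ j)
    have h2 := Finset.single_le_sum (f := fun i => ∑ j, |B i j|)
      (fun i _ => Finset.sum_nonneg fun j _ => abs_nonneg _) (Finset.mem_univ i)
    linarith
  set M : Matrix ι ι ℝ := Matrix.of B with hM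
  set C : Matrix ι ι ℝ := M + c • 1 with hC
  have hCoff : ∀ i j, i ≠ j → C i j = B i j := by
    intro i j h; simp [hC, hM, h]
  have hCd : ∀ i, 0 < C i i := by
    intro i; simp [hC, hM]
    have := (abs_le.1 (hBc i i)).1; linarith
  have hC0 : ∀ i j, 0 ≤ C i j := by
    intro i j
    by_cases h : i = j
    · subst h; exact (hCd i).le
    · rw [hCoff i j h]; exact hA i j h
  have hstep : ∀ x : ι → ℝ, (∀ i, 0 ≤ x i) → ∀ i j, C i j * x j ≤ (C *ᵥ x) i := by
    intro x hx i j
    exact Finset.single_le_sum (f := fun j => C i j * x j)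
      (fun k _ => mul_nonneg (hC0 i k) (hx k)) (Finset.mem_univ j)
  have hsucc : ∀ (x : ι → ℝ) k, (C ^ (k+1)) *ᵥ x = C *ᵥ ((C ^ k) *ᵥ x) := by
    intro x k; rw [pow_succ', Matrix.mulVec_mulVec]
  have hpn : ∀ x : ι → ℝ, (∀ i, 0 ≤ x i) → ∀ k i, 0 ≤ ((C ^ k) *ᵥ x) i := by
    intro x hx k
    induction k with
    | zero => simpa using hx
    | succ k ih =>
      intro i
      rw [hsucc]
      exact Finset.sum_nonneg fun j _ => mul_nonneg (hC0 i j) (ih j)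
  have hpp : ∀ x : ι → ℝ, (∀ i, 0 ≤ x i) → (∃ i, 0 < x i) →
      ∀ᶠ k in atTop, ∀ i, 0 < ((C ^ k) *ᵥ x) i := by
    intro x hx hne
    rw [eventually_all]
    apply hI (fun i => ∀ᶠ k in atTop, 0 < ((C ^ k) *ᵥ x) i)
    · obtain ⟨i, hi⟩ := hne
      refine ⟨i, Eventually.of_forall fun k => ?_⟩
      induction k with
      | zero => simpa using hi
      | succ k ih =>
        rw [hsucc]
        exact (mul_pos (hCd i) ih).trans_le (hstep _ (hpn x hx k) i i)
    · intro i j hij hj hpos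
      obtain ⟨N, hN⟩ := eventually_atTop.1 hj
      refine eventually_atTop.2 ⟨N + 1, fun k hk => ?_⟩
      obtain ⟨m, rfl⟩ : ∃ m, k = m + 1 := ⟨k - 1, by omega⟩
      rw [hsucc]
      have h1 := hN m (by omega)
      refine (mul_pos ?_ h1).trans_le (hstep _ (hpn x hx m) i j)
      rw [hCoff i j hij]; exact hpos
  -- Collatz-Wielandt
  set S : Set ((ι → ℝ) × ℝ) := (stdSimplex ℝ ι ×ˢ Set.Icc (-c) c) ∩
    {p | ∀ i, p.2 * p.1 i ≤ ∑ j, B i j * p.1 j} with hS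
  have hScl : IsClosed {p : (ι → ℝ) × ℝ | ∀ i, p.2 * p.1 i ≤ ∑ j, B i j * p.1 j} := by
    simp only [Set.ofPred_forall]
    exact isClosed_iInter fun i => isClosed_le (by fun_prop) (by fun_prop)
  have hScomp : IsCompact S := ((isCompact_stdSimplex ℝ ι).prod isCompact_Icc).inter_right hScl
  have hupper : ∀ (x : ι → ℝ) l, (∀ i, 0 ≤ x i) → ∑ i, x i = 1 →
      (∀ i, l * x i ≤ ∑ j, B i j * x j) → l ≤ c := by
    intro x l hx hsum h
    have h1 : ∑ i, l * x i ≤ ∑ i, ∑ j, |B i j| := by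
      apply Finset.sum_le_sum
      intro i _
      refine (h i).trans (Finset.sum_le_sum fun j _ => ?_)
      have hxj : x j ≤ 1 := hsum ▸ Finset.single_le_sum (f := x) (fun j _ => hx j)
        (Finset.mem_univ j)
      calc B i j * x j ≤ |B i j| * x j := mul_le_mul_of_nonneg_right (le_abs_self _) (hx j)
        _ ≤ |B i j| * 1 := mul_le_mul_of_nonneg_left hxj (abs_nonneg _)
        _ = _ := mul_one _
    rw [← Finset.mul_sum, hsum] at h1
    linarith
  have hMx : ∀ (x : ι → ℝ) i, (M *ᵥ x) i = ∑ j, B i j * x j := fun x i => rfl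
  have hCx : ∀ (x : ι → ℝ) i, (C *ᵥ x) i = ∑ j, B i j * x j + c * x i := by
    intro x i
    rw [hC, Matrix.add_mulVec, Matrix.smul_mulVec, Matrix.one_mulVec]
    simp [hMx]
  have hSne : S.Nonempty := by
    obtain ⟨i0⟩ := ‹Nonempty ι›
    refine ⟨(Pi.single i0 1, -c), ⟨single_mem_stdSimplex ℝ i0, ⟨le_rfl, ?_⟩⟩, ?_⟩
    · have := (abs_nonneg _).trans (hBc i0 i0); linarith
    · intro i
      have hx : ∀ j, 0 ≤ (Pi.single i0 (1:ℝ) : ι → ℝ) j := fun j => by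
        by_cases h : j = i0
        · subst h; simp
        · simp [h]
      have h1 : 0 ≤ (C *ᵥ (Pi.single i0 (1:ℝ) : ι → ℝ)) i :=
        Finset.sum_nonneg fun j _ => mul_nonneg (hC0 i j) (hx j)
      rw [hCx] at h1
      simp only
      linarith
  obtain ⟨⟨φ, l⟩, ⟨⟨⟨hφ0, hφ1⟩, hl⟩, hφ⟩, hmax⟩ := hScomp.exists_isMaxOn hSne
    (f := fun p : (ι → ℝ) × ℝ => p.2) (by fun_prop)
  simp only [Set.mem_ofPred_eq] at hφ0 hφ1 hφ hl
  have hφne : ∃ i, 0 < φ i := by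
    by_contra h
    push Not at h
    have := Finset.sum_nonpos (s := Finset.univ) (fun i _ => h i)
    linarith
  have heq : ∀ i, ∑ j, B i j * φ j = l * φ i := by
    by_contra hcon
    push Not at hcon
    obtain ⟨i0, hi0⟩ := hcon
    set w : ι → ℝ := M *ᵥ φ - l • φ with hw
    have hwi : ∀ i, w i = ∑ j, B i j * φ j - l * φ i := fun i => rfl
    have hw0 : ∀ i, 0 ≤ w i := fun i => by rw [hwi]; have := hφ i; linarith
    have hwne : ∃ i, 0 < w i := ⟨i0, lt_of_le_of_ne (hw0 i0) (by
      rw [hwi]; intro h; apply hi0; linarith)⟩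
    obtain ⟨k, hk1, hk2⟩ := ((hpp φ hφ0 hφne).and (hpp w hw0 hwne)).exists
    set y := (C ^ k) *ᵥ φ with hy
    have hcomm : M * C ^ k = C ^ k * M := by
      have h : Commute M C := by
        rw [hC]; exact (Commute.refl M).add_right ((Commute.one_right M).smul_right c)
      exact h.pow_right k
    have hyw : ∀ i, ((C ^ k) *ᵥ w) i = ∑ j, B i j * y j - l * y i := by
      intro i
      rw [hw, Matrix.mulVec_sub, Matrix.mulVec_smul, Matrix.mulVec_mulVec, ← hcomm,
        ← Matrix.mulVec_mulVec]
      rfl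
    obtain ⟨e, he, hee⟩ := exists_unif_pos (fun i => ((C ^ k) *ᵥ w) i / y i)
      (fun i => div_pos (hk2 i) (hk1 i))
    have hsy : 0 < ∑ i, y i := Finset.sum_pos (fun i _ => hk1 i) Finset.univ_nonempty
    have hz1 : ∑ i, (∑ i, y i)⁻¹ * y i = 1 := by
      rw [← Finset.mul_sum]; exact inv_mul_cancel₀ hsy.ne'
    have hz0 : ∀ i, 0 ≤ (∑ i, y i)⁻¹ * y i := fun i =>
      mul_nonneg (inv_nonneg.2 hsy.le) (hk1 i).le
    have hz2 : ∀ i, (l + e) * ((∑ i, y i)⁻¹ * y i) ≤ ∑ j, B i j * ((∑ i, y i)⁻¹ * y j) := by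
      intro i
      have h1 := (le_div_iff₀ (hk1 i)).1 (hee i)
      rw [hyw] at h1
      have h2 : ∑ j, B i j * ((∑ i, y i)⁻¹ * y j) = (∑ i, y i)⁻¹ * ∑ j, B i j * y j := by
        rw [Finset.mul_sum]; congr 1; ext j; ring
      rw [h2]
      have h3 := mul_le_mul_of_nonneg_left (by linarith : (l + e) * y i ≤ ∑ j, B i j * y j)
        (inv_nonneg.2 hsy.le)
      linarith
    have hmem : ((fun i => (∑ i, y i)⁻¹ * y i, l + e) : (ι → ℝ) × ℝ) ∈ S :=
      ⟨⟨⟨hz0, hz1⟩, ⟨by linarith [hl.1], hupper _ _ hz0 hz1 hz2⟩⟩, hz2⟩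
    have : l + e ≤ l := hmax hmem
    linarith
  refine ⟨φ, l, ?_, heq⟩
  apply hI.pos hA hφ0 hφne
  intro i hi
  rw [heq i, hi]; simp

lemma exists_ls (f : ℝ → ℝ) (K : ℝ) (hf : ∀ t, 0 ≤ t → |f t| ≤ K) :
    ∃ V, (∀ δ > 0, ∀ᶠ t in atTop, f t < V + δ) ∧ (∀ δ > 0, ∃ᶠ t in atTop, V - δ < f t) := by
  have hb1 : IsBoundedUnder (· ≤ ·) atTop f :=
    ⟨K, eventually_map.2 ((eventually_ge_atTop 0).mono fun t ht => (abs_le.1 (hf t ht)).2)⟩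
  have hb2 : IsBoundedUnder (· ≥ ·) atTop f :=
    ⟨-K, eventually_map.2 ((eventually_ge_atTop 0).mono fun t ht => (abs_le.1 (hf t ht)).1)⟩
  refine ⟨limsup f atTop, fun δ hδ => ?_, fun δ hδ => ?_⟩
  · exact eventually_lt_of_limsup_lt (by linarith) hb1
  · exact frequently_lt_of_lt_limsup hb2.isCoboundedUnder_le (by linarith)

lemma fluct (f F : ℝ → ℝ) (V : ℝ) (hf : ∀ t, 0 ≤ t → HasDerivAt f (F t) t)
    (h2 : ∀ δ > 0, ∃ᶠ t in atTop, V - δ < f t)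
    (H : ℝ × ℝ → ℝ) (hH : Continuous H)
    (h1 : ∀ δ > 0, ∀ᶠ t in atTop, f t < V + δ)
    (hF : ∀ δ > 0, ∀ᶠ t in atTop, F t ≤ H (δ, f t - V)) : 0 ≤ H (0, 0) := by
  by_contra hcon
  push Not at hcon
  set c := H (0, 0) with hc
  obtain ⟨e, he, hball⟩ := Metric.eventually_nhds_iff.1
    (hH.continuousAt.eventually (gt_mem_nhds (by rw [← hc]; linarith : H (0,0) < c / 2)))
  have hδ : 0 < e / 2 := by linarith
  obtain ⟨T0, hT0⟩ := eventually_atTop.1 ((h1 _ hδ).and (hF _ hδ))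
  set T := max T0 0 with hT
  have hTT : ∀ t, T ≤ t → 0 ≤ t ∧ (V - e/2 ≤ f t → F t < c / 2) := by
    intro t ht
    refine ⟨(le_max_right _ _).trans ht, fun hft => ?_⟩
    obtain ⟨h3, h4⟩ := hT0 t ((le_max_left _ _).trans ht)
    refine h4.trans_lt (hball ?_)
    rw [Prod.dist_eq, max_lt_iff]
    simp only [Real.dist_eq, sub_zero, abs_lt]
    constructor <;> constructor <;> linarith
  -- at some point f drops below
  have hdrop : ∃ t1, T ≤ t1 ∧ f t1 < V - e/2 := by
    by_contra hno
    push Not at hno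
    have hanti : AntitoneOn (fun t => f t - c / 2 * t) (Set.Ici T) := by
      have hd : ∀ t, T ≤ t → HasDerivAt (fun t => f t - c / 2 * t) (F t - c / 2) t := by
        intro t ht
        refine (hf t (hTT t ht).1).sub ?_
        simpa using (hasDerivAt_id t).const_mul (c/2)
      apply antitoneOn_of_deriv_nonpos (convex_Ici T)
      · intro t ht; exact (hd t ht).continuousAt.continuousWithinAt
      · intro t ht; rw [interior_Ici] at ht
        exact (hd t (le_of_lt ht)).differentiableAt.differentiableWithinAt
      · intro t ht; rw [interior_Ici] at ht
        rw [(hd t (le_of_lt ht)).deriv]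
        have := (hTT t (le_of_lt ht)).2 (hno t (le_of_lt ht))
        linarith
    set s := (|f T - (V - e/2)| + 1) / (-(c/2)) with hs
    have hs0 : 0 < s := div_pos (by positivity) (by linarith)
    have h5 := hanti (Set.mem_Ici.2 le_rfl) (Set.mem_Ici.2 (by linarith : T ≤ T + s))
      (by linarith)
    have h6 := hno (T + s) (by linarith)
    have h7 : s * (-(c/2)) = |f T - (V - e/2)| + 1 := div_mul_cancel₀ _ (by linarith)
    have := le_abs_self (f T - (V - e/2))
    simp only at h5
    linarith
  obtain ⟨t1, ht1, hft1⟩ := hdrop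
  obtain ⟨t, ht, ht'⟩ := ((h2 _ hδ).and_eventually (eventually_ge_atTop t1)).exists
  have := barrier (ι := Unit) (fun t _ => V - e/2 - f t) (fun t _ => - F t) t1 t
    (by
      intro _ s hs _
      simpa using (hf s (hTT s (ht1.trans hs)).1).const_sub (V - e/2))
    (by
      intro s hs _ _ _ h0
      have := (hTT s (ht1.trans hs)).2 (by linarith)
      linarith)
    (by intro _; linarith) t ht' le_rfl ()
  linarith

lemma fluct_sup {A : ι → ι → ℝ} (hA : Met A) (r : ℝ) (u v : ℝ → ι → ℝ)
    (hu : ∀ i, ∀ t : ℝ, 0 ≤ t → HasDerivAt (fun s => u s i)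
      ((∑ j, A i j * u t j) + u t i * (r - u t i - v t i)) t)
    (hu0 : ∀ t, 0 ≤ t → ∀ i, 0 ≤ u t i)
    (U V : ι → ℝ)
    (h1 : ∀ i, ∀ δ > 0, ∀ᶠ t in atTop, u t i < U i + δ)
    (h2 : ∀ i, ∀ δ > 0, ∃ᶠ t in atTop, U i - δ < u t i)
    (h3 : ∀ i, ∀ δ > 0, ∀ᶠ t in atTop, V i - δ < v t i) :
    ∀ i, 0 ≤ (∑ j, A i j * U j) + U i * (r - U i - V i) := by
  classical
  intro i
  have := fluct (fun s => u s i) _ (U i) (hu i) (h2 i)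
    (fun p => (∑ j, A i j * (if j = i then U i + p.2 else U j + p.1))
      + (U i + p.2) * (r - (U i + p.2) - (V i - p.1)))
    (by
      refine Continuous.add (continuous_finsetSum _ fun j _ => ?_) (by fun_prop)
      split_ifs <;> fun_prop) (h1 i)
    (by
      intro δ hδ
      filter_upwards [eventually_all.2 (fun j => h1 j δ hδ), h3 i δ hδ, eventually_ge_atTop 0]
        with t ha hb hc
      have h4 := hA.sum_le (i := i) (x := u t)
        (y := fun j => if j = i then U i + (u t i - U i) else U j + δ)
        (by intro j; split_ifs with h
            · subst h; linarith
            · exact (ha j).le) (by simp)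
      have h5 := mul_le_mul_of_nonneg_left (by linarith : r - u t i - v t i ≤
        r - (U i + (u t i - U i)) - (V i - δ)) (hu0 t hc i)
      have h6 : U i + (u t i - U i) = u t i := by ring
      rw [h6] at h4 h5 ⊢
      linarith)
  have h7 : (fun j => A i j * (if j = i then U i + 0 else U j + 0)) = fun j => A i j * U j := by
    ext j; split_ifs with h
    · rw [h, add_zero]
    · rw [add_zero]
  simp only [h7] at this
  simpa using this

lemma fluct_inf {A : ι → ι → ℝ} (hA : Met A) (r : ℝ) (u v : ℝ → ι → ℝ)
    (hu : ∀ i, ∀ t : ℝ, 0 ≤ t → HasDerivAt (fun s => u s i)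
      ((∑ j, A i j * u t j) + u t i * (r - u t i - v t i)) t)
    (hu0 : ∀ t, 0 ≤ t → ∀ i, 0 ≤ u t i)
    (U V : ι → ℝ)
    (h1 : ∀ i, ∀ δ > 0, ∀ᶠ t in atTop, U i - δ < u t i)
    (h2 : ∀ i, ∀ δ > 0, ∃ᶠ t in atTop, u t i < U i + δ)
    (h3 : ∀ i, ∀ δ > 0, ∀ᶠ t in atTop, v t i < V i + δ) :
    ∀ i, (∑ j, A i j * U j) + U i * (r - U i - V i) ≤ 0 := by
  classical
  intro i
  have := fluct (fun s => - u s i) _ (- U i) (fun t ht => (hu i t ht).neg)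
    (fun δ hδ => (h2 i δ hδ).mono fun t ht => by linarith)
    (fun p => -((∑ j, A i j * (if j = i then U i - p.2 else U j - p.1))
      + (U i - p.2) * (r - (U i - p.2) - (V i + p.1))))
    (by
      refine (Continuous.add (continuous_finsetSum _ fun j _ => ?_) (by fun_prop)).neg
      split_ifs <;> fun_prop)
    (fun δ hδ => (h1 i δ hδ).mono fun t ht => by linarith)
    (by
      intro δ hδ
      filter_upwards [eventually_all.2 (fun j => h1 j δ hδ), h3 i δ hδ, eventually_ge_atTop 0]
        with t ha hb hc
      have h4 := hA.sum_le (i := i) (y := u t)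
        (x := fun j => if j = i then U i - (-u t i - -U i) else U j - δ)
        (by intro j; split_ifs with h
            · subst h; linarith
            · exact (ha j).le) (by simp)
      have h5 := mul_le_mul_of_nonneg_left (by linarith : 
        r - (U i - (-u t i - -U i)) - (V i + δ) ≤ r - u t i - v t i) (hu0 t hc i)
      have h6 : U i - (-u t i - -U i) = u t i := by ring
      rw [h6] at h4 h5 ⊢
      linarith)
  have h7 : (fun j => A i j * (if j = i then U i - 0 else U j - 0)) = fun j => A i j * U j := by
    ext j; split_ifs with h
    · rw [h, sub_zero]
    · rw [sub_zero]
  simp only [h7] at this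
  simp only [sub_zero, add_zero] at this
  linarith

lemma sol_bdd {A : ι → ι → ℝ} (hA : Met A) (hR : RowS A) (r : ℝ) (u v : ℝ → ι → ℝ)
    (hu : ∀ i, ∀ t : ℝ, 0 ≤ t → HasDerivAt (fun s => u s i)
      ((∑ j, A i j * u t j) + u t i * (r - u t i - v t i)) t)
    (hu0 : ∀ t, 0 ≤ t → ∀ i, 0 ≤ u t i) (hv0 : ∀ t, 0 ≤ t → ∀ i, 0 ≤ v t i) :
    ∃ K, ∀ t, 0 ≤ t → ∀ i, |u t i| ≤ K := by
  set K := |r| + ∑ i, u 0 i + 1 with hK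
  have hS := Finset.sum_nonneg (s := Finset.univ) (fun i _ => hu0 0 le_rfl i)
  have hr := le_abs_self r
  have hr' := abs_nonneg r
  refine ⟨K, fun t ht i => ?_⟩
  rw [abs_of_nonneg (hu0 t ht i)]
  have := barrier (fun t i => K - u t i)
    (fun t i => -((∑ j, A i j * u t j) + u t i * (r - u t i - v t i))) 0 t
    (fun i s hs _ => by simpa using (hu i s hs).const_sub K)
    (by
      intro s hs _ hz i hi
      have hui : u s i = K := by linarith
      have h1 := hA.sum_le (i := i) (x := u s) (y := fun _ => K)
        (fun j => by have := hz j; linarith) hui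
      simp only [← Finset.sum_mul] at h1
      have h2 := hR i
      have h3 := hv0 s hs i
      rw [hui]
      have hK0 : 0 < K := by linarith
      have h4 : K * (r - K - v s i) < 0 := mul_neg_of_pos_of_neg hK0 (by linarith)
      have h5 : (∑ j, A i j) * K ≤ 0 := mul_nonpos_of_nonpos_of_nonneg h2 hK0.le
      linarith)
    (by
      intro i
      have := Finset.single_le_sum (f := u 0) (fun i _ => hu0 0 le_rfl i) (Finset.mem_univ i)
      linarith) t ht le_rfl i
  linarith

lemma persist {A : ι → ι → ℝ} (hA : Met A) (r : ℝ) (u v : ℝ → ι → ℝ)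
    (hu : ∀ i, ∀ t : ℝ, 0 ≤ t → HasDerivAt (fun s => u s i)
      ((∑ j, A i j * u t j) + u t i * (r - u t i - v t i)) t)
    (hpos : ∀ t, 0 < t → ∀ i, 0 < u t i)
    (V : ι → ℝ) (h3 : ∀ i, ∀ δ > 0, ∀ᶠ t in atTop, v t i < V i + δ)
    (φ : ι → ℝ) (hφ : ∀ i, 0 < φ i) (μ : ℝ) (hμ : 0 < μ)
    (hsub : ∀ i, μ * φ i ≤ (∑ j, A i j * φ j) + φ i * (r - V i)) :
    ∃ e > 0, (∀ i, e * φ i ≤ μ / 2) ∧ ∀ᶠ t in atTop, ∀ i, e * φ i < u t i := by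
  obtain ⟨T0, hT0⟩ := eventually_atTop.1 (eventually_all.2 (fun j => h3 j (μ/4) (by linarith)))
  set T := max T0 1 with hT
  have hT1 : 1 ≤ T := le_max_right _ _
  obtain ⟨e1, he1, he1'⟩ := exists_unif_pos (fun i => μ / 2 / φ i)
    (fun i => div_pos (by linarith) (hφ i))
  obtain ⟨e2, he2, he2'⟩ := exists_unif_pos (fun i => u T i / φ i)
    (fun i => div_pos (hpos T (by linarith) i) (hφ i))
  set e := min e1 (e2 / 2) with he
  have hepos : 0 < e := lt_min he1 (by linarith)
  have hea : ∀ i, e * φ i ≤ μ / 2 := fun i =>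
    (le_div_iff₀ (hφ i)).1 ((min_le_left _ _).trans (he1' i))
  have heb : ∀ i, e * φ i < u T i := fun i =>
    (lt_div_iff₀ (hφ i)).1 (((min_le_right _ _).trans_lt (by linarith)).trans_le (he2' i))
  refine ⟨e, hepos, hea, eventually_atTop.2 ⟨T, fun t ht i => ?_⟩⟩
  have := barrier (fun t i => u t i - e * φ i)
    (fun t i => ((∑ j, A i j * u t j) + u t i * (r - u t i - v t i))) T t
    (fun i s hs _ => by simpa using (hu i s (by linarith)).sub_const (e * φ i))
    (by
      intro s hs _ hz i hi
      have hui : u s i = e * φ i := by linarith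
      have h1 := hA.sum_le (i := i) (y := u s) (x := fun j => e * φ j)
        (fun j => by have := hz j; linarith) hui.symm
      have h2 : ∑ j, A i j * (e * φ j) = e * ∑ j, A i j * φ j := by
        rw [Finset.mul_sum]; congr 1; ext j; ring
      rw [h2] at h1
      have h4 := hT0 s ((le_max_left _ _).trans hs) i
      rw [hui]
      have h5 := mul_le_mul_of_nonneg_left (hsub i) hepos.le
      have h6 : 0 < e * φ i := mul_pos hepos (hφ i)
      have h7 : 0 < e * φ i * (μ - e * φ i - (v s i - V i)) :=
        mul_pos h6 (by have := hea i; linarith)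
      nlinarith)
    (by intro i; have := heb i; linarith) t ht le_rfl i
  linarith

theorem core {A B : ι → ι → ℝ} (hA : Met A) (hAI : Irr A) (hAR : RowS A)
    (hB : Met B) (hBI : Irr B) (hBR : RowS B) (r : ℝ)
    (H1 : ∀ s : ι → ℝ, (∀ i, 0 < s i) → (∀ i, (∑ j, B i j * s j) + s i * (r - s i) = 0) →
      ∃ φ : ι → ℝ, ∃ μ > 0, (∀ i, 0 < φ i) ∧
        ∀ i, (∑ j, A i j * φ j) + φ i * (r - s i) = μ * φ i)
    (H2 : ∀ x y : ι → ℝ, (∀ i, 0 < x i) → (∀ i, 0 < y i) →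
      (∀ i, (∑ j, A i j * x j) + x i * (r - x i - y i) = 0) →
      (∀ i, (∑ j, B i j * y j) + y i * (r - x i - y i) = 0) → False)
    (w : ι → ℝ) (hw : ∀ i, 0 < w i) (hweq : ∀ i, (∑ j, A i j * w j) + w i * (r - w i) = 0)
    (u v : ℝ → ι → ℝ)
    (hu : ∀ i, ∀ t : ℝ, 0 ≤ t → HasDerivAt (fun s => u s i)
      ((∑ j, A i j * u t j) + u t i * (r - u t i - v t i)) t)
    (hv : ∀ i, ∀ t : ℝ, 0 ≤ t → HasDerivAt (fun s => v s i)
      ((∑ j, B i j * v t j) + v t i * (r - u t i - v t i)) t)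
    (hu0 : ∀ i, 0 ≤ u 0 i) (hv0 : ∀ i, 0 ≤ v 0 i) (hne : u 0 ≠ 0) :
    ∀ i, Tendsto (fun t => u t i) atTop (nhds (w i)) ∧
           Tendsto (fun t => v t i) atTop (nhds 0) := by
  have hg : ∀ i, ∀ t, 0 ≤ t → ContinuousAt (fun s => r - u s i - v s i) t := fun i t ht =>
    (continuousAt_const.sub (hu i t ht).continuousAt).sub (hv i t ht).continuousAt
  have hun := sol_nonneg hA (fun s i => r - u s i - v s i) u hg hu hu0
  have hup := sol_pos hA hAI (fun s i => r - u s i - v s i) u hg hu hu0 hne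
  have hvn := sol_nonneg hB (fun s i => r - u s i - v s i) v hg hv hv0
  have hv' : ∀ i, ∀ t : ℝ, 0 ≤ t → HasDerivAt (fun s => v s i)
      ((∑ j, B i j * v t j) + v t i * (r - v t i - u t i)) t := by
    intro i t ht
    have := hv i t ht
    rwa [sub_right_comm] at this
  obtain ⟨Ku, hKu⟩ := sol_bdd hA hAR r u v hu hun hvn
  obtain ⟨Kv, hKv⟩ := sol_bdd hB hBR r v u hv' hvn hun
  choose Us hUs1 hUs2 using fun i => exists_ls (fun t => u t i) Ku (fun t ht => hKu t ht i)
  choose Vs hVs1 hVs2 using fun i => exists_ls (fun t => v t i) Kv (fun t ht => hKv t ht i)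
  choose Ui' hUi1' hUi2' using fun i => exists_ls (fun t => - u t i) Ku
    (fun t ht => by rw [abs_neg]; exact hKu t ht i)
  set Ui : ι → ℝ := fun i => - Ui' i with hUi
  have hUi1 : ∀ i, ∀ δ > 0, ∀ᶠ t in atTop, Ui i - δ < u t i := fun i δ hδ =>
    (hUi1' i δ hδ).mono fun t ht => by simp only [hUi]; linarith
  have hUi2 : ∀ i, ∀ δ > 0, ∃ᶠ t in atTop, u t i < Ui i + δ := fun i δ hδ =>
    (hUi2' i δ hδ).mono fun t ht => by simp only [hUi]; linarith
  have hUlow : ∀ (i : ι) (a : ℝ), (∀ᶠ t in atTop, a < u t i) → a ≤ Ui i := by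
    intro i a h
    apply le_of_forall_pos_le_add
    intro δ hδ
    obtain ⟨t, h1, h2⟩ := ((hUi2 i δ hδ).and_eventually h).exists
    linarith
  have hUi0 : ∀ i, 0 ≤ Ui i := fun i => hUlow i 0
    ((eventually_gt_atTop 0).mono fun t ht => hup t ht i)
  have hVs0 : ∀ i, 0 ≤ Vs i := by
    intro i
    apply le_of_forall_pos_le_add
    intro δ hδ
    obtain ⟨t, h1, h2⟩ := ((hVs1 i δ hδ).and (eventually_ge_atTop 0)).exists
    have := hvn t h2 i
    linarith
  have hVeq := fluct_sup hB r v u hv' hvn Vs Ui hVs1 hVs2 hUi1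
  have hUeq := fluct_inf hA r u v hu hun Ui Vs hUi1 hUi2 hVs1
  have hUseq := fluct_sup hA r u v hu hun Us (fun _ => 0) hUs1 hUs2 (by
    intro i δ hδ
    filter_upwards [eventually_ge_atTop 0] with t ht
    have := hvn t ht i
    linarith)
  have hVs : ∀ i, Vs i = 0 := by
    by_contra hcon
    push Not at hcon
    have hVne : ∃ i, 0 < Vs i := by
      obtain ⟨i, hi⟩ := hcon
      exact ⟨i, lt_of_le_of_ne (hVs0 i) hi.symm⟩
    obtain ⟨s, hs, hVles, hseq⟩ := star_exists hB hBI hBR r Vs hVs0 hVne (by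
      intro i
      have := hVeq i
      have := mul_nonneg (hVs0 i) (hUi0 i)
      linarith)
    obtain ⟨φ, μ, hμ, hφ, hφeq⟩ := H1 s hs hseq
    obtain ⟨e, he, hea, heb⟩ := persist hA r u v hu hup Vs hVs1 φ hφ μ hμ (by
      intro i
      rw [← hφeq i]
      have := mul_le_mul_of_nonneg_left (hVles i) (hφ i).le
      linarith)
    have hUφ : ∀ i, e * φ i ≤ Ui i := fun i => hUlow i _ (heb.mono fun t ht => ht i)
    obtain ⟨x, hax, hxb, hx⟩ := qm_exists (κ := ι ⊕ ι)
      (fun x => Sum.elim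
        (fun i => -((∑ j, A i j * (- x (Sum.inl j)))
          + (- x (Sum.inl i)) * (r - (- x (Sum.inl i)) - x (Sum.inr i))))
        (fun i => (∑ j, B i j * x (Sum.inr j))
          + x (Sum.inr i) * (r - (- x (Sum.inl i)) - x (Sum.inr i))))
      (by
        refine continuous_pi fun i => ?_
        rcases i with i | i
        · simp only [Sum.elim_inl]; fun_prop
        · simp only [Sum.elim_inr]; fun_prop)
      (Sum.elim (fun i => - Ui i) Vs) (Sum.elim (fun i => -(e * φ i)) s)
      (by
        intro i
        rcases i with i | i
        · simpa using hUφ i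
        · simpa using hVles i)
      (by
        intro x y hax hxy hyb i hi
        rcases i with i | i
        · simp only [Sum.elim_inl]
          have h1 := hA.sum_le (i := i) (x := fun j => - y (Sum.inl j))
            (y := fun j => - x (Sum.inl j)) (fun j => neg_le_neg (hxy (Sum.inl j)))
            (by rw [hi])
          have h2 := hxy (Sum.inr i)
          have h3 := hyb (Sum.inl i)
          simp only [Sum.elim_inl] at h3
          have h4 := mul_pos he (hφ i)
          rw [hi]
          nlinarith
        · simp only [Sum.elim_inr]
          have h1 := hB.sum_le (i := i) (x := fun j => x (Sum.inr j))
            (y := fun j => y (Sum.inr j)) (fun j => (hxy (Sum.inr j)))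
            hi
          have h2 := hxy (Sum.inl i)
          have h3 := (hax.trans hxy) (Sum.inr i)
          simp only [Sum.elim_inr] at h3
          have h4 := hVs0 i
          rw [hi]
          nlinarith)
      (by
        intro i
        rcases i with i | i
        · simp only [Sum.elim_inl, Sum.elim_inr, neg_neg]
          have := hUeq i; linarith
        · simp only [Sum.elim_inl, Sum.elim_inr, neg_neg]
          have := hVeq i; rw [sub_right_comm] at this; exact this)
      (by
        intro i
        rcases i with i | i
        · simp only [Sum.elim_inl, Sum.elim_inr, neg_neg]
          have h2 : ∑ j, A i j * (e * φ j) = e * ∑ j, A i j * φ j := by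
            rw [Finset.mul_sum]; congr 1; ext j; ring
          rw [h2]
          have h3 := hφeq i
          have h4 := hea i
          have h5 : 0 ≤ e * φ i * (μ - e * φ i) :=
            mul_nonneg (mul_pos he (hφ i)).le (by linarith)
          have h6 : e * (∑ j, A i j * φ j + φ i * (r - s i)) = e * (μ * φ i) := by rw [h3]
          nlinarith
        · simp only [Sum.elim_inl, Sum.elim_inr, neg_neg]
          have h3 := hseq i
          have h4 := mul_pos (hs i) (mul_pos he (hφ i))
          nlinarith)
    refine H2 (fun i => - x (Sum.inl i)) (fun i => x (Sum.inr i)) ?_ ?_ ?_ ?_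
    · intro i
      have h3 := hxb (Sum.inl i)
      simp only [Sum.elim_inl] at h3
      have h4 := mul_pos he (hφ i)
      linarith
    · have hxV : ∀ i, Vs i ≤ x (Sum.inr i) := fun i => hax (Sum.inr i)
      apply hBI.pos hB (fun j => (hVs0 j).trans (hxV j))
      · obtain ⟨i, hi⟩ := hVne; exact ⟨i, hi.trans_le (hxV i)⟩
      · intro i hi
        have := hx (Sum.inr i)
        simp only [Sum.elim_inr] at this
        rw [hi] at this
        linarith
    · intro i
      have := hx (Sum.inl i)
      simp only [Sum.elim_inl] at this
      linarith
    · intro i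
      exact hx (Sum.inr i)
  obtain ⟨μ, hμ, hμw⟩ := exists_unif_pos w hw
  obtain ⟨e, he, hea, heb⟩ := persist hA r u v hu hup Vs hVs1 w hw μ hμ (by
      intro i
      have h1 := hweq i
      rw [hVs i]
      have h2 := mul_le_mul_of_nonneg_right (hμw i) (hw i).le
      linarith)
  have hUpos : ∀ i, 0 < Ui i := fun i =>
    (mul_pos he (hw i)).trans_le (hUlow i _ (heb.mono fun t ht => ht i))
  have hwU : ∀ i, w i ≤ Ui i := sub_le_super hA r Ui w hUpos
    (fun i => by have := hUeq i; rwa [hVs i, sub_zero] at this) (fun i => (hweq i).ge)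
  have hUw : ∀ i, Us i ≤ w i := sub_le_super hA r w Us hw (fun i => (hweq i).le)
    (fun i => by have := hUseq i; rwa [sub_zero] at this)
  intro i
  constructor
  · rw [Metric.tendsto_nhds]
    intro δ hδ
    filter_upwards [hUs1 i δ hδ, hUi1 i δ hδ] with t h1 h2
    rw [Real.dist_eq, abs_lt]
    have := hwU i
    have := hUw i
    constructor <;> linarith
  · rw [Metric.tendsto_nhds]
    intro δ hδ
    filter_upwards [hVs1 i δ hδ, eventually_ge_atTop 0] with t h1 h2
    rw [Real.dist_eq, abs_lt]
    have := hVs i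
    have := hvn t h2 i
    constructor <;> linarith

end LVcore

/-- chain form of the stationary equation on indices `0, …, M+1` -/
def ChEq (d q : ℝ) (M : ℕ) (m X : ℕ → ℝ) : Prop :=
  d * (X 1 - X 0) = (q - m 0) * X 0 ∧
  (∀ i, i < M → d * (X (i+2) - X (i+1)) = (d + q) * (X (i+1) - X i) - m (i+1) * X (i+1)) ∧
  (d + q) * (X (M+1) - X M) = m (M+1) * X (M+1)

lemma ch_rule1 {d q d' q' : ℝ} {M : ℕ} {r : ℝ} {m X Y : ℕ → ℝ}
    (hd : 0 < d) (hq : 0 < q) (hd' : 0 < d') (hq' : 0 < q')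
    (hX : ∀ i, i ≤ M + 1 → 0 < X i) (hY : ∀ i, i ≤ M + 1 → 0 < Y i)
    (hm : ∀ i, m i = r - X i - Y i) (eX : ChEq d q M m X) (eY : ChEq d' q' M m Y) :
    ∀ k i, i + k = M → X (i+1) ≤ X i → Y (i+1) ≤ Y i → 0 < m i → False := by
  intro k
  induction k with
  | zero =>
    intro i hi h1 h2 h3
    obtain rfl : i = M := by omega
    have h4 : 0 < m (i+1) := by have := hm i; have := hm (i+1); linarith
    have := mul_pos h4 (hX (i+1) le_rfl)
    have := eX.2.2
    nlinarith
  | succ k ih =>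
    intro i hi h1 h2 h3
    have h4 : 0 < m (i+1) := by have := hm i; have := hm (i+1); linarith
    refine ih (i+1) (by omega) ?_ ?_ h4
    · have := mul_pos h4 (hX (i+1) (by omega))
      have := eX.2.1 i (by omega)
      by_contra hc
      push Not at hc
      have := mul_pos hd (sub_pos.2 hc)
      nlinarith
    · have := mul_pos h4 (hY (i+1) (by omega))
      have := eY.2.1 i (by omega)
      by_contra hc
      push Not at hc
      have := mul_pos hd' (sub_pos.2 hc)
      nlinarith

lemma ch_rule2 {d q d' q' : ℝ} {M : ℕ} {r : ℝ} {m X Y : ℕ → ℝ}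
    (hd : 0 < d) (hq : 0 < q) (hd' : 0 < d') (hq' : 0 < q')
    (hX : ∀ i, i ≤ M + 1 → 0 < X i) (hY : ∀ i, i ≤ M + 1 → 0 < Y i)
    (hm : ∀ i, m i = r - X i - Y i) (eX : ChEq d q M m X) (eY : ChEq d' q' M m Y) :
    ∀ k i, i + k = M → X i < X (i+1) → Y i < Y (i+1) → m i ≤ 0 → False := by
  intro k
  induction k with
  | zero =>
    intro i hi h1 h2 h3
    obtain rfl : i = M := by omega
    have h4 : m (i+1) < 0 := by have := hm i; have := hm (i+1); linarith
    have := mul_neg_of_neg_of_pos h4 (hX (i+1) le_rfl)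
    have := eX.2.2
    nlinarith
  | succ k ih =>
    intro i hi h1 h2 h3
    have h4 : m (i+1) < 0 := by have := hm i; have := hm (i+1); linarith
    refine ih (i+1) (by omega) ?_ ?_ h4.le
    · have := mul_neg_of_neg_of_pos h4 (hX (i+1) (by omega))
      have := eX.2.1 i (by omega)
      have := mul_pos (add_pos hd hq) (sub_pos.2 h1)
      by_contra hc
      push Not at hc
      have := mul_nonneg hd.le (sub_nonneg.2 hc)
      have : (i + 1 + 1) = i + 2 := rfl
      rw [this] at *
      linarith
    · have := mul_neg_of_neg_of_pos h4 (hY (i+1) (by omega))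
      have := eY.2.1 i (by omega)
      have := mul_pos (add_pos hd' hq') (sub_pos.2 h2)
      by_contra hc
      push Not at hc
      have := mul_nonneg hd'.le (sub_nonneg.2 hc)
      have : (i + 1 + 1) = i + 2 := rfl
      rw [this] at *
      linarith

lemma ch_rule3 {d q d' q' : ℝ} {M : ℕ} {r : ℝ} {m X Y : ℕ → ℝ}
    (hd : 0 < d) (hq : 0 < q) (hd' : 0 < d') (hq' : 0 < q')
    (hX : ∀ i, i ≤ M + 1 → 0 < X i) (hY : ∀ i, i ≤ M + 1 → 0 < Y i)
    (hm : ∀ i, m i = r - X i - Y i) (eX : ChEq d q M m X) (eY : ChEq d' q' M m Y) :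
    ∀ k i, i + k = M → X (i+1) ≤ X i → Y i < Y (i+1) → False := by
  have R1 := ch_rule1 hd hq hd' hq' hX hY hm eX eY
  have R2 := ch_rule2 hd hq hd' hq' hX hY hm eX eY
  intro k
  induction k with
  | zero =>
    intro i hi h1 h2
    obtain rfl : i = M := by omega
    have e1 := eX.2.2
    have e2 := eY.2.2
    have h3 : 0 < m (i+1) := by
      have := mul_pos (add_pos hd' hq') (sub_pos.2 h2)
      rw [e2] at this
      exact pos_of_mul_pos_left this (hY (i+1) le_rfl).le
    have := mul_pos h3 (hX (i+1) le_rfl)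
    have := mul_nonneg (add_pos hd hq).le (sub_nonneg.2 h1)
    linarith
  | succ k ih =>
    intro i hi h1 h2
    have e1 := eX.2.1 i (by omega)
    have e2 := eY.2.1 i (by omega)
    have p1 := mul_nonneg (add_pos hd hq).le (sub_nonneg.2 h1)
    have p2 := mul_pos (add_pos hd' hq') (sub_pos.2 h2)
    rcases lt_or_ge 0 (m (i+1)) with h3 | h3
    · have h4 : X (i+1+1) ≤ X (i+1) := by
        have := mul_pos h3 (hX (i+1) (by omega))
        have h5 : d * (X (i+2) - X (i+1)) < 0 := by linarith
        exact (sub_neg.1 (neg_of_mul_neg_right h5 hd.le)).le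
      refine ih (i+1) (by omega) h4 ?_
      by_contra hc
      exact R1 k (i+1) (by omega) h4 (not_lt.1 hc) h3
    · have h4 : Y (i+1) < Y (i+1+1) := by
        have := mul_nonpos_of_nonpos_of_nonneg h3 (hY (i+1) (by omega)).le
        have h5 : 0 < d' * (Y (i+2) - Y (i+1)) := by linarith
        exact sub_pos.1 (pos_of_mul_pos_right h5 hd'.le)
      refine ih (i+1) (by omega) ?_ h4
      by_contra hc
      exact R2 k (i+1) (by omega) (not_le.1 hc) h4 h3

lemma ch_mono {d q d' q' : ℝ} {M : ℕ} {r : ℝ} {m X Y : ℕ → ℝ}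
    (hd : 0 < d) (hq : 0 < q) (hd' : 0 < d') (hq' : 0 < q')
    (hX : ∀ i, i ≤ M + 1 → 0 < X i) (hY : ∀ i, i ≤ M + 1 → 0 < Y i)
    (hm : ∀ i, m i = r - X i - Y i) (eX : ChEq d q M m X) (eY : ChEq d' q' M m Y) :
    ∀ i, i ≤ M → X i < X (i+1) ∧ Y i < Y (i+1) := by
  have R1 := ch_rule1 hd hq hd' hq' hX hY hm eX eY
  have R3 := ch_rule3 hd hq hd' hq' hX hY hm eX eY
  have R3' := ch_rule3 hd' hq' hd hq hY hX (fun i => by rw [hm i]; ring) eY eX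
  have key : ∀ i, i ≤ M → (X (i+1) ≤ X i → 0 < m i) → X i < X (i+1) ∧ Y i < Y (i+1) := by
    intro i hi hmi
    rcases lt_or_ge (X i) (X (i+1)) with h1 | h1 <;> rcases lt_or_ge (Y i) (Y (i+1)) with h2 | h2
    · exact ⟨h1, h2⟩
    · exact (R3' (M - i) i (by omega) h2 h1).elim
    · exact (R3 (M - i) i (by omega) h1 h2).elim
    · exact (R1 (M - i) i (by omega) h1 h2 (hmi h1)).elim
  intro i
  induction i with
  | zero =>
    intro hi
    apply key 0 hi
    intro h
    have e := eX.1
    have p := mul_nonneg hd.le (sub_nonneg.2 h)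
    simp only [zero_add] at p
    have h5 : 0 ≤ (m 0 - q) * X 0 := by linarith
    have := nonneg_of_mul_nonneg_left h5 (hX 0 (by omega))
    linarith
  | succ i ih =>
    intro hi
    apply key _ hi
    intro h
    have h1 := (ih (by omega)).1
    have e := eX.2.1 i (by omega)
    have p1 := mul_nonneg hd.le (sub_nonneg.2 h)
    have p2 := mul_pos (add_pos hd hq) (sub_pos.2 h1)
    have : (i + 1 + 1) = i + 2 := rfl
    rw [this] at p1
    have h5 : 0 < m (i+1) * X (i+1) := by linarith
    exact pos_of_mul_pos_left h5 (hX (i+1) (by omega)).le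

lemma ch_flux {d q : ℝ} {M : ℕ} {k X : ℕ → ℝ} (hq : 0 < q)
    (hX : ∀ i, i ≤ M + 1 → 0 < X i) (hk : ∀ i, i ≤ M → k (i+1) ≤ k i) (eX : ChEq d q M k X) :
    ∀ i, i ≤ M → 0 < (d + q) * X i - d * X (i+1) := by
  have claim : ∀ j i, i + j = M → (d + q) * X i - d * X (i+1) ≤ 0 → k i ≤ 0 → False := by
    intro j
    induction j with
    | zero =>
      intro i hi h1 h2
      obtain rfl : i = M := by omega
      have h3 := (hk i le_rfl).trans h2
      have := mul_nonpos_of_nonpos_of_nonneg h3 (hX (i+1) le_rfl).le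
      have := mul_pos hq (hX (i+1) le_rfl)
      have := eX.2.2
      linarith
    | succ j ih =>
      intro i hi h1 h2
      have h3 := (hk i (by omega)).trans h2
      refine ih (i+1) (by omega) ?_ h3
      have := mul_nonpos_of_nonpos_of_nonneg h3 (hX (i+1) (by omega)).le
      have := eX.2.1 i (by omega)
      have e : (i + 1 + 1) = i + 2 := rfl
      rw [e]
      linarith
  intro i
  induction i with
  | zero =>
    intro hi
    by_contra hc
    push Not at hc
    refine claim M 0 (by omega) hc ?_
    have := eX.1
    simp only [zero_add] at hc
    by_contra h
    have := mul_pos (not_le.1 h) (hX 0 (by omega))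
    linarith
  | succ i ih =>
    intro hi
    by_contra hc
    push Not at hc
    refine claim (M-(i+1)) (i+1) (by omega) hc ?_
    have := eX.2.1 i (by omega)
    have := ih (by omega)
    by_contra h
    have := mul_pos (not_le.1 h) (hX (i+1) (by omega))
    have e : (i + 1 + 1) = i + 2 := rfl
    rw [e] at hc
    linarith

lemma ch_key {dw qw dl ql : ℝ} {M : ℕ} {k m φ s : ℕ → ℝ}
    (hdw : 0 < dw) (hqw : 0 < qw)
    (hrel : (ql = qw ∧ dl < dw) ∨ (dl = dw ∧ qw < ql))
    (hφ : ∀ i, i ≤ M + 1 → 0 < φ i) (hs : ∀ i, i ≤ M + 1 → 0 < s i)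
    (hk : ∀ i, i ≤ M → k (i+1) ≤ k i) (hmk : ∀ i, i ≤ M + 1 → m i ≤ k i)
    (hinc : ∀ i, i ≤ M → s i < s (i+1))
    (eφ : ChEq dw qw M k φ) (es : ChEq dl ql M m s) : False := by
  have hmk' : ∀ i, i ≤ M + 1 → 0 ≤ (k i - m i) * (φ i * s i) := fun i hi =>
    mul_nonneg (sub_nonneg.2 (hmk i hi)) (mul_pos (hφ i hi) (hs i hi)).le
  rcases hrel with ⟨rfl, hlt⟩ | ⟨rfl, hlt⟩
  · have hfl := ch_flux hqw hφ hk eφ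
    -- E i = dw * C i + δ φ_i g_i
    have hE : ∀ i, i ≤ M → dw * (φ (i+1) * s i - φ i * s (i+1))
        + (dw - dl) * φ i * (s (i+1) - s i) ≤ 0 := by
      intro i
      induction i with
      | zero =>
        intro _
        have e1 := eφ.1
        have e2 := es.1
        have := hmk' 0 (by omega)
        simp only [zero_add]
        have : dw * (φ 1 * s 0 - φ 0 * s 1) + (dw - dl) * φ 0 * (s 1 - s 0)
          = - ((k 0 - m 0) * (φ 0 * s 0)) := by
          linear_combination s 0 * e1 - φ 0 * e2
        linarith
      | succ i ih =>
        intro hi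
        have ih := ih (by omega)
        have e1 := eφ.2.1 i (by omega)
        have e2 := es.2.1 i (by omega)
        have h1 := hmk' (i+1) (by omega)
        have h2 := mul_pos (mul_pos (sub_pos.2 hlt) (sub_pos.2 (hinc i (by omega))))
          (hfl i (by omega))
        have h3 : dw * (dw * (φ (i+2) * s (i+1) - φ (i+1) * s (i+2))
            + (dw - dl) * φ (i+1) * (s (i+2) - s (i+1)))
          = (dw + ql) * (dw * (φ (i+1) * s i - φ i * s (i+1))
              + (dw - dl) * φ i * (s (i+1) - s i))
            - (dw - dl) * (s (i+1) - s i) * ((dw + ql) * φ i - dw * φ (i+1))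
            - dw * ((k (i+1) - m (i+1)) * (φ (i+1) * s (i+1))) := by
          linear_combination dw * s (i+1) * e1 - dw * φ (i+1) * e2
        have h4 := mul_nonneg hdw.le h1
        have h5 := mul_nonpos_of_nonneg_of_nonpos (add_pos hdw hqw).le ih
        by_contra hc
        push Not at hc
        have := mul_pos hdw hc
        have e : (i + 1 + 1) = i + 2 := rfl
        rw [e] at this
        linarith
    have ih := hE M le_rfl
    have e1 := eφ.2.2
    have e2 := es.2.2
    have h1 := hmk' (M+1) (by omega)
    have h2 := mul_pos (mul_pos (sub_pos.2 hlt) (sub_pos.2 (hinc M (by omega))))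
      (hfl M (by omega))
    have h3 : 0
      = (dw + ql) * (dw * (φ (M+1) * s M - φ M * s (M+1))
          + (dw - dl) * φ M * (s (M+1) - s M))
        - (dw - dl) * (s (M+1) - s M) * ((dw + ql) * φ M - dw * φ (M+1))
        - dw * ((k (M+1) - m (M+1)) * (φ (M+1) * s (M+1))) := by
      linear_combination -(dw * s (M+1) * e1) + dw * φ (M+1) * e2
    have h4 := mul_nonneg hdw.le h1
    have h5 := mul_nonpos_of_nonneg_of_nonpos (add_pos hdw hqw).le ih
    linarith
  · have hC : ∀ i, i ≤ M → φ (i+1) * s i - φ i * s (i+1) ≤ 0 := by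
      intro i
      induction i with
      | zero =>
        intro _
        have e1 := eφ.1
        have e2 := es.1
        have h1 := hmk' 0 (by omega)
        have h2 := mul_pos (sub_pos.2 hlt) (mul_pos (hφ 0 (by omega)) (hs 0 (by omega)))
        simp only [zero_add]
        have h3 : dl * (φ 1 * s 0 - φ 0 * s 1)
          = - ((k 0 - m 0) * (φ 0 * s 0)) - (ql - qw) * (φ 0 * s 0) := by
          linear_combination s 0 * e1 - φ 0 * e2
        by_contra hc
        push Not at hc
        have := mul_pos hdw hc
        linarith
      | succ i ih =>
        intro hi
        have ih := ih (by omega)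
        have e1 := eφ.2.1 i (by omega)
        have e2 := es.2.1 i (by omega)
        have h1 := hmk' (i+1) (by omega)
        have h2 := mul_pos (mul_pos (sub_pos.2 hlt) (sub_pos.2 (hinc i (by omega))))
          (hφ (i+1) (by omega))
        have h3 : dl * (φ (i+2) * s (i+1) - φ (i+1) * s (i+2))
          = (dl + qw) * (φ (i+1) * s i - φ i * s (i+1))
            - (ql - qw) * (s (i+1) - s i) * φ (i+1)
            - (k (i+1) - m (i+1)) * (φ (i+1) * s (i+1)) := by
          linear_combination s (i+1) * e1 - φ (i+1) * e2
        have h5 := mul_nonpos_of_nonneg_of_nonpos (add_pos hdw hqw).le ih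
        by_contra hc
        push Not at hc
        have := mul_pos hdw hc
        have e : (i + 1 + 1) = i + 2 := rfl
        rw [e] at this
        linarith
    have ih := hC M le_rfl
    have e1 := eφ.2.2
    have e2 := es.2.2
    have h1 := hmk' (M+1) (by omega)
    have h2 := mul_pos (mul_pos (sub_pos.2 hlt) (sub_pos.2 (hinc M (by omega))))
      (hφ (M+1) (by omega))
    have h3 : 0 = (dl + qw) * (φ (M+1) * s M - φ M * s (M+1))
            - (ql - qw) * (s (M+1) - s M) * φ (M+1)
            - (k (M+1) - m (M+1)) * (φ (M+1) * s (M+1)) := by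
      linear_combination -(s (M+1) * e1) + φ (M+1) * e2
    have h5 := mul_nonpos_of_nonneg_of_nonpos (add_pos hdw hqw).le ih
    linarith

/-- the movement matrix -/
def Mv (n : ℕ) (d q : ℝ) : Fin n → Fin n → ℝ := fun i j => d * Da n i j + q * Qm n i j

lemma sum_fin_ite (n a : ℕ) (c : ℝ) :
    ∑ j : Fin n, (if (j : ℕ) = a then c else 0) = if a < n then c else 0 := by
  rw [Fin.sum_univ_eq_sum_range (fun j => if j = a then c else 0) n, Finset.sum_ite_eq']
  simp

lemma row_formula (n : ℕ) (d q : ℝ) (X : ℕ → ℝ) (i : Fin n) :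
    ∑ j : Fin n, Mv n d q i j * X j =
      (if (i : ℕ) + 1 < n then d * X (i + 1) else 0)
      + (if 0 < (i : ℕ) then (d + q) * X (i - 1) else 0)
      + (-q - (if (i : ℕ) = 0 ∨ (i : ℕ) = n - 1 then d else 2 * d)) * X i := by
  have h : ∀ j : Fin n, Mv n d q i j * X j =
      (if (j : ℕ) = (i : ℕ) + 1 then d * X (i + 1) else 0)
      + (if (j : ℕ) = (i : ℕ) - 1 then (if 0 < (i : ℕ) then (d + q) * X (i - 1) else 0) else 0)
      + (if (j : ℕ) = (i : ℕ) then
        (-q - (if (i : ℕ) = 0 ∨ (i : ℕ) = n - 1 then d else 2 * d)) * X i else 0) := by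
    intro j
    unfold Mv Da Qm
    by_cases h1 : (j : ℕ) = (i : ℕ) + 1
    · have a1 : (i : ℕ) + 1 = (j : ℕ) := h1.symm
      have a2 : ¬ (j : ℕ) + 1 = (i : ℕ) := by omega
      have a3 : ¬ i = j := by intro h; subst h; omega
      have a4 : ¬ (j : ℕ) = (i : ℕ) - 1 := by omega
      have a5 : ¬ (j : ℕ) = (i : ℕ) := by omega
      simp only [a2, a3, a1, if_pos, if_false, true_or, if_true, ← h1, if_neg a4, if_neg a5]
      ring
    · have a1 : ¬ (i : ℕ) + 1 = (j : ℕ) := fun h => h1 h.symm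
      by_cases h2 : (j : ℕ) + 1 = (i : ℕ)
      · have a3 : ¬ i = j := by intro h; subst h; omega
        have a4 : (j : ℕ) = (i : ℕ) - 1 := by omega
        have a5 : ¬ (j : ℕ) = (i : ℕ) := by omega
        have a6 : 0 < (i : ℕ) := by omega
        simp only [h2, or_true, if_true, if_neg h1, if_pos a4, if_neg a5, if_pos a6, ← a4]
        ring
      · by_cases h3 : i = j
        · subst h3
          have a4 : (i : ℕ) = (i : ℕ) - 1 → ¬ 0 < (i : ℕ) := by omega
          have a5 : (if (i : ℕ) = (i : ℕ) - 1 then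
            (if 0 < (i : ℕ) then (d + q) * X (i - 1) else 0) else 0) = 0 := by
            split_ifs with h h' <;> [exact absurd h' (a4 h); rfl; rfl]
          rw [a5]
          simp only [a1, h2, h1, or_self, if_false, if_true]
          split_ifs <;> ring
        · have a5 : ¬ (j : ℕ) = (i : ℕ) := fun h => h3 (Fin.ext h.symm)
          have a4 : (j : ℕ) = (i : ℕ) - 1 → ¬ 0 < (i : ℕ) := by omega
          have a6 : (if (j : ℕ) = (i : ℕ) - 1 then
            (if 0 < (i : ℕ) then (d + q) * X (i - 1) else 0) else 0) = 0 := by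
            split_ifs with h h' <;> [exact absurd h' (a4 h); rfl; rfl]
          rw [a6]
          simp only [a1, h2, h1, h3, a5, or_self, if_false]
          ring
  rw [Finset.sum_congr rfl (fun j _ => h j), Finset.sum_add_distrib, Finset.sum_add_distrib,
    sum_fin_ite, sum_fin_ite, sum_fin_ite]
  have b1 := i.isLt
  have b2 : (i : ℕ) - 1 < n := by omega
  rw [if_pos b1, if_pos b2]

lemma Mv_adj {n : ℕ} {d q : ℝ} (hd : 0 < d) (hq : 0 < q) (i j : Fin n)
    (h : (i : ℕ) + 1 = j ∨ (j : ℕ) + 1 = i) : 0 < Mv n d q i j := by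
  unfold Mv Da Qm
  rw [if_pos h]
  split_ifs with h1 h2
  · linarith
  · subst h2; omega
  · linarith

lemma Mv_met {n : ℕ} {d q : ℝ} (hd : 0 < d) (hq : 0 < q) : Met (Mv n d q) := by
  intro i j hij
  by_cases h : (i : ℕ) + 1 = j ∨ (j : ℕ) + 1 = i
  · exact (Mv_adj hd hq i j h).le
  · unfold Mv Da Qm
    rw [if_neg h, if_neg hij, if_neg (fun h' => h (Or.inr h')), if_neg hij]
    simp

lemma Mv_irr {n : ℕ} {d q : ℝ} (hd : 0 < d) (hq : 0 < q) : Irr (Mv n d q) := by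
  intro P ⟨i0, hi0⟩ hP
  have hP' : ∀ i j : Fin n, ((i : ℕ) + 1 = j ∨ (j : ℕ) + 1 = i) → P j → P i := by
    intro i j h hj
    exact hP i j (by intro h'; subst h'; omega) hj (Mv_adj hd hq i j h)
  have up : ∀ k (h : (i0 : ℕ) + k < n), P ⟨i0 + k, h⟩ := by
    intro k
    induction k with
    | zero => intro h; exact hi0
    | succ k ih =>
      intro h
      exact hP' _ ⟨i0 + k, by omega⟩ (Or.inr rfl) (ih (by omega))
  have down : ∀ k (h : (i0 : ℕ) - k < n), P ⟨i0 - k, h⟩ := by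
    intro k
    induction k with
    | zero => intro h; exact hi0
    | succ k ih =>
      intro h
      have ih' := ih (by omega)
      by_cases hk : (i0 : ℕ) ≤ k
      · have : (⟨i0 - (k+1), h⟩ : Fin n) = ⟨i0 - k, by omega⟩ := Fin.ext (by simp only; omega)
        rw [this]; exact ih'
      · exact hP' _ ⟨i0 - k, by omega⟩ (Or.inl (by simp only; omega)) ih'
  intro i
  rcases le_total (i0 : ℕ) i with h | h
  · have := up (i - i0) (by omega)
    have e : (⟨(i0 : ℕ) + (i - i0), by omega⟩ : Fin n) = i := Fin.ext (by simp only; omega)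
    rwa [e] at this
  · have := down (i0 - i) (by omega)
    have e : (⟨(i0 : ℕ) - (i0 - i), by omega⟩ : Fin n) = i := Fin.ext (by simp only; omega)
    rwa [e] at this

lemma Mv_rowS {n : ℕ} {d q : ℝ} (hn : 2 ≤ n) (hd : 0 < d) (hq : 0 < q) : RowS (Mv n d q) := by
  intro i
  have := row_formula n d q (fun _ => 1) i
  simp only [mul_one] at this
  rw [this]
  have := i.isLt
  split_ifs <;> first | linarith | omega

/-- extension by zero -/
noncomputable def ext0 {n : ℕ} (x : Fin n → ℝ) : ℕ → ℝ :=
  fun k => if h : k < n then x ⟨k, h⟩ else 0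

lemma ext0_val {n : ℕ} (x : Fin n → ℝ) (j : Fin n) : ext0 x j = x j := by
  simp [ext0]

lemma ext0_pos {M : ℕ} (x : Fin (M+2) → ℝ) (hx : ∀ i, 0 < x i) : ∀ i, i ≤ M + 1 → 0 < ext0 x i := by
  intro i hi
  have h : i < M + 2 := by omega
  simp only [ext0, h, dif_pos]
  exact hx _

lemma cheq_of {M : ℕ} {d q : ℝ} (x : Fin (M+2) → ℝ) (m : ℕ → ℝ)
    (h : ∀ i, (∑ j, Mv (M+2) d q i j * x j) + x i * m i = 0) : ChEq d q M m (ext0 x) := by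
  have h' : ∀ k (hk : k < M + 2), (if k + 1 < M + 2 then d * ext0 x (k + 1) else 0)
      + (if 0 < k then (d + q) * ext0 x (k - 1) else 0)
      + (-q - (if k = 0 ∨ k = M + 2 - 1 then d else 2 * d)) * ext0 x k + ext0 x k * m k = 0 := by
    intro k hk
    have h1 := h ⟨k, hk⟩
    have h2 := row_formula (M+2) d q (ext0 x) ⟨k, hk⟩
    simp only [ext0_val] at h2
    rw [h2, ← ext0_val x ⟨k, hk⟩] at h1
    exact h1
  refine ⟨?_, ?_, ?_⟩
  · have := h' 0 (by omega)
    simp at this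
    linarith
  · intro i hi
    have := h' (i+1) (by omega)
    have a1 : i + 1 + 1 < M + 2 := by omega
    have a2 : 0 < i + 1 := by omega
    have a3 : ¬ (i + 1 = 0 ∨ i + 1 = M + 2 - 1) := by omega
    rw [if_pos a1, if_pos a2, if_neg a3] at this
    have e : (i + 1 + 1) = i + 2 := rfl
    rw [e, Nat.add_sub_cancel] at this
    linarith
  · have := h' (M+1) (by omega)
    have a1 : ¬ M + 1 + 1 < M + 2 := by omega
    have a2 : 0 < M + 1 := by omega
    have a3 : (M + 1 = 0 ∨ M + 1 = M + 2 - 1) := by omega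
    rw [if_neg a1, if_pos a2, if_pos a3, Nat.add_sub_cancel] at this
    linarith

lemma star_mono {M : ℕ} {d q r : ℝ} (hd : 0 < d) (hq : 0 < q) (s : Fin (M+2) → ℝ)
    (hs : ∀ i, 0 < s i) (he : ∀ i, (∑ j, Mv (M+2) d q i j * s j) + s i * (r - s i) = 0) :
    ∀ i, i ≤ M → ext0 s i < ext0 s (i+1) := by
  have e := cheq_of s (fun i => r - ext0 s i) (fun i => by simp only [ext0_val]; exact he i)
  have e2 : ChEq d q M (fun i => r - ext0 s i / 2 - ext0 s i / 2) (fun i => ext0 s i / 2) := by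
    refine ⟨?_, fun i hi => ?_, ?_⟩
    · have := e.1; simp only at this ⊢; linarith
    · have := e.2.1 i hi; simp only at this ⊢; linarith
    · have := e.2.2; simp only at this ⊢; linarith
  have hp : ∀ i, i ≤ M + 1 → 0 < ext0 s i / 2 := fun i hi => by
    have := ext0_pos s hs i hi; linarith
  intro i hi
  have := (ch_mono (r := r) hd hq hd hq hp hp (fun i => rfl) e2 e2 i hi).1
  linarith

lemma conc_H1 {M : ℕ} {dw qw dl ql r : ℝ} (hdw : 0 < dw) (hqw : 0 < qw) (hdl : 0 < dl)
    (hql : 0 < ql) (hrel : (ql = qw ∧ dl < dw) ∨ (dl = dw ∧ qw < ql))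
    (s : Fin (M+2) → ℝ) (hs : ∀ i, 0 < s i)
    (he : ∀ i, (∑ j, Mv (M+2) dl ql i j * s j) + s i * (r - s i) = 0) :
    ∃ φ : Fin (M+2) → ℝ, ∃ μ > 0, (∀ i, 0 < φ i) ∧
        ∀ i, (∑ j, Mv (M+2) dw qw i j * φ j) + φ i * (r - s i) = μ * φ i := by
  have hoff : ∀ i j : Fin (M+2), i ≠ j →
      Mv (M+2) dw qw i j + (if i = j then r - s i else 0) = Mv (M+2) dw qw i j := by
    intro i j h; rw [if_neg h, add_zero]
  obtain ⟨φ, l, hφ, hl⟩ := perron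
    (fun i j : Fin (M+2) => Mv (M+2) dw qw i j + (if i = j then r - s i else 0))
    (fun i j h => by simp only [hoff i j h]; exact Mv_met hdw hqw i j h)
    (fun P h1 h2 => Mv_irr hdw hqw P h1 (fun i j hij hj hpos => h2 i j hij hj (by
      simp only [hoff i j hij]; exact hpos)))
  have hl' : ∀ i, (∑ j, Mv (M+2) dw qw i j * φ j) + φ i * (r - s i) = l * φ i := by
    intro i
    rw [← hl i]
    simp only [add_mul, Finset.sum_add_distrib, ite_mul, zero_mul, Finset.sum_ite_eq,
      Finset.mem_univ, if_true]
    ring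
  refine ⟨φ, l, ?_, hφ, hl'⟩
  by_contra hc
  push Not at hc
  have hinc := star_mono hdl hql s hs he
  refine ch_key hdw hqw hrel (k := fun i => r - ext0 s i - l) (m := fun i => r - ext0 s i)
    (ext0_pos φ hφ) (ext0_pos s hs) (fun i hi => ?_) (fun i hi => ?_) hinc
    (cheq_of φ _ (fun i => ?_)) (cheq_of s _ (fun i => ?_))
  · have := hinc i hi; linarith
  · linarith
  · simp only [ext0_val]; have := hl' i; linarith
  · simp only [ext0_val]; exact he i

lemma conc_H2 {M : ℕ} {dw qw dl ql r : ℝ} (hdw : 0 < dw) (hqw : 0 < qw) (hdl : 0 < dl)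
    (hql : 0 < ql) (hrel : (ql = qw ∧ dl < dw) ∨ (dl = dw ∧ qw < ql))
    (x y : Fin (M+2) → ℝ) (hx : ∀ i, 0 < x i) (hy : ∀ i, 0 < y i)
    (ex : ∀ i, (∑ j, Mv (M+2) dw qw i j * x j) + x i * (r - x i - y i) = 0)
    (ey : ∀ i, (∑ j, Mv (M+2) dl ql i j * y j) + y i * (r - x i - y i) = 0) : False := by
  have e1 := cheq_of x (fun i => r - ext0 x i - ext0 y i)
    (fun i => by simp only [ext0_val]; exact ex i)
  have e2 := cheq_of y (fun i => r - ext0 x i - ext0 y i)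
    (fun i => by simp only [ext0_val]; exact ey i)
  have hm := ch_mono (r := r) hdw hqw hdl hql (ext0_pos x hx) (ext0_pos y hy)
    (fun i => rfl) e1 e2
  exact ch_key hdw hqw hrel (ext0_pos x hx) (ext0_pos y hy)
    (fun i hi => by have := hm i hi; linarith [this.1, this.2])
    (fun i hi => le_rfl) (fun i hi => (hm i hi).2) e1 e2

lemma conc_core {M : ℕ} {dw qw dl ql r : ℝ} (hdw : 0 < dw) (hqw : 0 < qw) (hdl : 0 < dl)
    (hql : 0 < ql) (hrel : (ql = qw ∧ dl < dw) ∨ (dl = dw ∧ qw < ql))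
    (w : Fin (M+2) → ℝ) (hw : ∀ i, 0 < w i)
    (hweq : ∀ i, (∑ j, Mv (M+2) dw qw i j * w j) + w i * (r - w i) = 0)
    (u v : ℝ → Fin (M+2) → ℝ)
    (hu : ∀ i, ∀ t : ℝ, 0 ≤ t → HasDerivAt (fun s => u s i)
      ((∑ j, Mv (M+2) dw qw i j * u t j) + u t i * (r - u t i - v t i)) t)
    (hv : ∀ i, ∀ t : ℝ, 0 ≤ t → HasDerivAt (fun s => v s i)
      ((∑ j, Mv (M+2) dl ql i j * v t j) + v t i * (r - u t i - v t i)) t)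
    (hu0 : ∀ i, 0 ≤ u 0 i) (hv0 : ∀ i, 0 ≤ v 0 i) (hne : u 0 ≠ 0) :
    ∀ i, Tendsto (fun t => u t i) atTop (nhds (w i)) ∧
           Tendsto (fun t => v t i) atTop (nhds 0) :=
  core (Mv_met hdw hqw) (Mv_irr hdw hqw) (Mv_rowS (by omega) hdw hqw)
    (Mv_met hdl hql) (Mv_irr hdl hql) (Mv_rowS (by omega) hdl hql) r
    (fun s hs he => conc_H1 hdw hqw hdl hql hrel s hs he)
    (fun x y hx hy ex ey => conc_H2 hdw hqw hdl hql hrel x y hx hy ex ey)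
    w hw hweq u v hu hv hu0 hv0 hne

lemma conc_core2 {M : ℕ} {dw qw dl ql r : ℝ} (hdw : 0 < dw) (hqw : 0 < qw) (hdl : 0 < dl)
    (hql : 0 < ql) (hrel : (ql = qw ∧ dl < dw) ∨ (dl = dw ∧ qw < ql))
    (s : Fin (M+2) → ℝ) (hs : ∀ i, 0 < s i)
    (hseq : ∀ i, (∑ j, Mv (M+2) dl ql i j * s j) + s i * (r - s i) = 0)
    (u v : ℝ → Fin (M+2) → ℝ)
    (hu : ∀ i, ∀ t : ℝ, 0 ≤ t → HasDerivAt (fun s => u s i)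
      ((∑ j, Mv (M+2) dl ql i j * u t j) + u t i * (r - u t i - v t i)) t)
    (hv : ∀ i, ∀ t : ℝ, 0 ≤ t → HasDerivAt (fun s => v s i)
      ((∑ j, Mv (M+2) dw qw i j * v t j) + v t i * (r - u t i - v t i)) t)
    (hu0 : ∀ i, 0 ≤ u 0 i) (hv0 : ∀ i, 0 ≤ v 0 i) (hne : v 0 ≠ 0) :
    ∃ vstar : Fin (M+2) → ℝ, (∀ i, 0 < vstar i) ∧
        (∀ i, (∑ j, Mv (M+2) dw qw i j * vstar j) + vstar i * (r - vstar i) = 0) ∧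
        (∀ w : Fin (M+2) → ℝ, (∀ i, 0 < w i) →
          (∀ i, (∑ j, Mv (M+2) dw qw i j * w j) + w i * (r - w i) = 0) → w = vstar) ∧
        ∀ i, Tendsto (fun t => u t i) atTop (nhds 0) ∧
             Tendsto (fun t => v t i) atTop (nhds (vstar i)) := by
  obtain ⟨φ, μ, hμ, hφ, hφe⟩ := conc_H1 hdw hqw hdl hql hrel s hs hseq
  obtain ⟨e, he, hee⟩ := exists_unif_pos (fun i => μ / φ i) (fun i => div_pos hμ (hφ i))
  obtain ⟨w, hw, -, hweq⟩ := star_exists (Mv_met hdw hqw) (Mv_irr hdw hqw)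
    (Mv_rowS (by omega) hdw hqw) r (fun i => e * φ i) (fun i => (mul_pos he (hφ i)).le)
    ⟨0, mul_pos he (hφ 0)⟩ (by
      intro i
      have h2 : ∑ j, Mv (M+2) dw qw i j * (e * φ j) = e * ∑ j, Mv (M+2) dw qw i j * φ j := by
        rw [Finset.mul_sum]; congr 1; ext j; ring
      rw [h2]
      have h3 := (le_div_iff₀ (hφ i)).1 (hee i)
      have h4 : 0 ≤ e * φ i * (μ - e * φ i + s i) :=
        mul_nonneg (mul_pos he (hφ i)).le (by have := hs i; linarith)
      have h5 : e * (∑ j, Mv (M+2) dw qw i j * φ j + φ i * (r - s i)) = e * (μ * φ i) := by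
        rw [hφe i]
      nlinarith)
  refine ⟨w, hw, hweq, ?_, ?_⟩
  · intro w' hw' hweq'
    funext i
    apply le_antisymm
    · exact sub_le_super (Mv_met hdw hqw) r w w' hw (fun i => (hweq i).le)
        (fun i => (hweq' i).ge) i
    · exact sub_le_super (Mv_met hdw hqw) r w' w hw' (fun i => (hweq' i).le)
        (fun i => (hweq i).ge) i
  · intro i
    have := conc_core hdw hqw hdl hql hrel w hw hweq v u
      (fun i t ht => by have := hv i t ht; rwa [sub_right_comm] at this)
      (fun i t ht => by have := hu i t ht; rwa [sub_right_comm] at this) hv0 hu0 hne i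
    exact ⟨this.2, this.1⟩


/-- in case (a), with equal advection rates the species with the larger
diffusion rate excludes the other, and with equal diffusion rates the species with the
smaller advection rate excludes the other. -/
theorem stmt_18 (n : ℕ) (hn : 2 ≤ n) (r d₁ q₁ d₂ q₂ : ℝ)
    (hr : 0 < r) (hd1 : 0 < d₁) (hq1 : 0 < q₁) (hd2 : 0 < d₂) (hq2 : 0 < q₂)
    (ustar : Fin n → ℝ) (hustar : ∀ i, 0 < ustar i)
    (hueq : ∀ i, (∑ j, (d₁ * Da n i j + q₁ * Qm n i j) * ustar j)
      + ustar i * (r - ustar i) = 0)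
    (u v : ℝ → Fin n → ℝ)
    (hu : ∀ i, ∀ t : ℝ, 0 ≤ t → HasDerivAt (fun s => u s i)
      ((∑ j, (d₁ * Da n i j + q₁ * Qm n i j) * u t j)
        + u t i * (r - u t i - v t i)) t)
    (hv : ∀ i, ∀ t : ℝ, 0 ≤ t → HasDerivAt (fun s => v s i)
      ((∑ j, (d₂ * Da n i j + q₂ * Qm n i j) * v t j)
        + v t i * (r - u t i - v t i)) t)
    (hu0 : ∀ i, 0 ≤ u 0 i) (hv0 : ∀ i, 0 ≤ v 0 i) :
    ((q₂ = q₁ ∧ d₂ < d₁) → u 0 ≠ 0 →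
      ∀ i, Tendsto (fun t => u t i) atTop (nhds (ustar i)) ∧
           Tendsto (fun t => v t i) atTop (nhds 0)) ∧
    ((q₂ = q₁ ∧ d₁ < d₂) → v 0 ≠ 0 →
      ∃ vstar : Fin n → ℝ, (∀ i, 0 < vstar i) ∧
        (∀ i, (∑ j, (d₂ * Da n i j + q₂ * Qm n i j) * vstar j)
          + vstar i * (r - vstar i) = 0) ∧
        (∀ w : Fin n → ℝ, (∀ i, 0 < w i) →
          (∀ i, (∑ j, (d₂ * Da n i j + q₂ * Qm n i j) * w j)
            + w i * (r - w i) = 0) → w = vstar) ∧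
        ∀ i, Tendsto (fun t => u t i) atTop (nhds 0) ∧
             Tendsto (fun t => v t i) atTop (nhds (vstar i))) ∧
    ((d₂ = d₁ ∧ q₁ < q₂) → u 0 ≠ 0 →
      ∀ i, Tendsto (fun t => u t i) atTop (nhds (ustar i)) ∧
           Tendsto (fun t => v t i) atTop (nhds 0)) ∧
    ((d₂ = d₁ ∧ q₂ < q₁) → v 0 ≠ 0 →
      ∃ vstar : Fin n → ℝ, (∀ i, 0 < vstar i) ∧
        (∀ i, (∑ j, (d₂ * Da n i j + q₂ * Qm n i j) * vstar j)
          + vstar i * (r - vstar i) = 0) ∧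
        (∀ w : Fin n → ℝ, (∀ i, 0 < w i) →
          (∀ i, (∑ j, (d₂ * Da n i j + q₂ * Qm n i j) * w j)
            + w i * (r - w i) = 0) → w = vstar) ∧
        ∀ i, Tendsto (fun t => u t i) atTop (nhds 0) ∧
             Tendsto (fun t => v t i) atTop (nhds (vstar i))) := by
  obtain ⟨M, rfl⟩ : ∃ M, n = M + 2 := ⟨n - 2, by omega⟩
  refine ⟨?_, ?_, ?_, ?_⟩
  · intro h hne
    exact conc_core hd1 hq1 hd2 hq2 (Or.inl h) ustar hustar hueq u v hu hv hu0 hv0 hne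
  · intro h hne
    exact conc_core2 hd2 hq2 hd1 hq1 (Or.inl ⟨h.1.symm, h.2⟩) ustar hustar hueq u v hu hv
      hu0 hv0 hne
  · intro h hne
    exact conc_core hd1 hq1 hd2 hq2 (Or.inr h) ustar hustar hueq u v hu hv hu0 hv0 hne
  · intro h hne
    exact conc_core2 hd2 hq2 hd1 hq1 (Or.inr ⟨h.1.symm, h.2⟩) ustar hustar hueq u v hu hv
      hu0 hv0 hne
end

section
/- Consider case (b). Let r > 0 and d₁, q₁ > 0, and assume hypothesis H2*: there exist λ > 0 and w ≫ 0 with (d₁D + q₁Q + diag(r,…,r))w = λw (i.e., the principal eigenvalue λ₁(d₁,q₁,(r,…,r)) is positive). Let d₂, q₂ > 0 with (d₂,q₂) ∈ G₁* ∪ G₂*, where G₁* = {(d,q) : d₁ < d ≤ (d₁/q₁)q, (d,q) ≠ (d₁,q₁)} and G₂* = {(d,q) : (d₁/q₁)q ≤ d ≤ d₁, q > 0, (d,q) ≠ (d₁,q₁)}. Then there exists no pair (û, v̂) with ûᵢ > 0 and v̂ᵢ > 0 for all i satisfying, for every i = 1,…,n: Σ_{j=1}^n (d₁D_{ij} + q₁Q_{ij})û_j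 + û_i(r − û_i − v̂_i) = 0 and Σ_{j=1}^n (d₂D_{ij} + q₂Q_{ij})v̂_j + v̂_i(r − û_i − v̂_i) = 0. (The two-species competition model has no positive equilibrium.) -/
open Matrix Filter

theorem rowsum_zero (n : ℕ) (d q : ℝ) (U : ℕ → ℝ) (hU : U n = 0) (h0 : 0 < n) :
    (∑ j : Fin n, (d * Db n ⟨0, h0⟩ j + q * Qm n ⟨0, h0⟩ j) * U j) = d * (U 1 - U 0) - q * U 0 := by
  have h1 : ∀ j : Fin n, (d * Db n ⟨0, h0⟩ j + q * Qm n ⟨0, h0⟩ j) * U j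
      = (fun k : ℕ => (if k = 1 then d * U k else 0) + (if k = 0 then (- d - q) * U k else 0)) j := by
    rintro ⟨j, hj⟩
    simp only [Db, Qm, Fin.mk.injEq]
    split_ifs <;> first | contradiction | omega | ring1 | (exfalso; simp only [or_false] at *; omega)
  refine (Finset.sum_congr rfl (fun j _ => h1 j)).trans ((Fin.sum_univ_eq_sum_range
    (fun k : ℕ => (if k = 1 then d * U k else 0) + (if k = 0 then (- d - q) * U k else 0)) n).trans ?_)
  rw [Finset.sum_add_distrib,
    Finset.sum_ite_eq', Finset.sum_ite_eq']
  simp only [Finset.mem_range, h0, if_true]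
  split_ifs with h
  · ring
  · have : n = 1 := by omega
    subst this
    rw [hU]; ring

theorem rowsum_succ (n : ℕ) (d q : ℝ) (U : ℕ → ℝ) (hU : U n = 0) (i : ℕ) (hi : i + 1 < n) :
    (∑ j : Fin n, (d * Db n ⟨i + 1, hi⟩ j + q * Qm n ⟨i + 1, hi⟩ j) * U j)
      = (d * (U (i + 2) - U (i + 1)) - q * U (i + 1)) - (d * (U (i + 1) - U i) - q * U i) := by
  have h1 : ∀ j : Fin n, (d * Db n ⟨i + 1, hi⟩ j + q * Qm n ⟨i + 1, hi⟩ j) * U j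
      = (fun k : ℕ => (if k = i + 2 then d * U k else 0) + (if k = i + 1 then (- 2 * d - q) * U k else 0)
        + (if k = i then (d + q) * U k else 0)) j := by
    rintro ⟨j, hj⟩
    simp only [Db, Qm, Fin.mk.injEq]
    split_ifs <;> first | contradiction | omega | ring1 | (exfalso; simp only [or_false] at *; omega)
  refine (Finset.sum_congr rfl (fun j _ => h1 j)).trans ((Fin.sum_univ_eq_sum_range
    (fun k : ℕ => (if k = i + 2 then d * U k else 0) + (if k = i + 1 then (- 2 * d - q) * U k else 0)
        + (if k = i then (d + q) * U k else 0)) n).trans ?_)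
  rw [Finset.sum_add_distrib,
    Finset.sum_add_distrib, Finset.sum_ite_eq', Finset.sum_ite_eq', Finset.sum_ite_eq']
  have hi' : i < n := by omega
  simp only [Finset.mem_range, hi, hi', if_true]
  split_ifs with h
  · ring
  · have : n = i + 2 := by omega
    subst this
    rw [hU]; ring

theorem core_s19 (m : ℕ) (r d₁ q₁ d₂ q₂ : ℝ) (hd1 : 0 < d₁) (hq1 : 0 < q₁) (hq2 : 0 < q₂)
    (hd : d₁ ≤ d₂) (hq : q₁ * d₂ ≤ q₂ * d₁) (hs : d₁ + q₁ < d₂ + q₂)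
    (u v J K : ℕ → ℝ) (hu : ∀ i ≤ m, 0 < u i) (hv : ∀ i ≤ m, 0 < v i)
    (hu0 : u (m + 1) = 0) (hv0 : v (m + 1) = 0)
    (hJ : ∀ i, J i = d₁ * (u (i + 1) - u i) - q₁ * u i)
    (hK : ∀ i, K i = d₂ * (v (i + 1) - v i) - q₂ * v i)
    (eu0 : J 0 + u 0 * (r - u 0 - v 0) = 0) (ev0 : K 0 + v 0 * (r - u 0 - v 0) = 0)
    (eu : ∀ i < m, J (i + 1) - J i + u (i + 1) * (r - u (i + 1) - v (i + 1)) = 0)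
    (ev : ∀ i < m, K (i + 1) - K i + v (i + 1) * (r - u (i + 1) - v (i + 1)) = 0) : False := by
  have hd2 : 0 < d₂ := by linarith
  have run : ∀ i ≤ m, 0 < J i → 0 < K i → r - u i - v i < 0 → False := by
    intro i hi h1 h2 h3
    have key : ∀ k, i + k ≤ m → 0 < J (i + k) ∧ 0 < K (i + k) ∧
        r - u (i + k) - v (i + k) < 0 := by
      intro k
      induction k with
      | zero => intro _; exact ⟨h1, h2, h3⟩
      | succ k ih =>
        intro hk
        obtain ⟨a, b, c⟩ := ih (by omega)
        have pu := hu (i + k) (by omega)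
        have pv := hv (i + k) (by omega)
        have pu' := hu (i + k + 1) (by omega)
        have pv' := hv (i + k + 1) (by omega)
        have e1 := eu (i + k) (by omega)
        have e2 := ev (i + k) (by omega)
        have l1 : u (i + k) < u (i + k + 1) := by
          have := hJ (i + k)
          by_contra hc
          nlinarith [mul_pos hq1 pu]
        have l2 : v (i + k) < v (i + k + 1) := by
          have := hK (i + k)
          by_contra hc
          nlinarith [mul_pos hq2 pv]
        have f : r - u (i + k + 1) - v (i + k + 1) < 0 := by linarith
        have g1 := mul_neg_of_pos_of_neg pu' f
        have g2 := mul_neg_of_pos_of_neg pv' f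
        refine ⟨?_, ?_, f⟩
        · show 0 < J (i + k + 1)
          linarith
        · show 0 < K (i + k + 1)
          linarith
    have := (key (m - i) (by omega)).1
    rw [show i + (m - i) = m by omega, hJ, hu0] at this
    nlinarith [hu m le_rfl, mul_pos hd1 (hu m le_rfl), mul_pos hq1 (hu m le_rfl)]
  have main : ∀ i ≤ m, J i ≤ 0 ∧ J i * v i ≤ K i * u i := by
    intro i
    induction i with
    | zero =>
      intro _
      have pu := hu 0 (by omega)
      have pv := hv 0 (by omega)
      refine ⟨?_, ?_⟩
      · by_contra hc
        push Not at hc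
        have f : r - u 0 - v 0 < 0 := by
          by_contra hf
          push Not at hf
          linarith [mul_nonneg pu.le hf]
        exact run 0 (by omega) hc (by linarith [mul_neg_of_pos_of_neg pv f]) f
      · have a : J 0 = -(u 0 * (r - u 0 - v 0)) := by linarith
        have b : K 0 = -(v 0 * (r - u 0 - v 0)) := by linarith
        rw [a, b]; apply le_of_eq; ring
    | succ i ih =>
      intro hi
      obtain ⟨a, b⟩ := ih (by omega)
      have pu := hu i (by omega)
      have pv := hv i (by omega)
      have pu' := hu (i + 1) hi
      have pv' := hv (i + 1) hi
      have e1 := eu i (by omega)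
      have e2 := ev i (by omega)
      have step : J i * v (i + 1) ≤ K i * u (i + 1) := by
        rcases le_or_gt 0 (K i) with hk | hk
        · nlinarith [mul_nonneg hk pu'.le, mul_nonneg (neg_nonneg.2 a) pv'.le]
        · have x1 : d₂ * v (i + 1) = K i + (d₂ + q₂) * v i := by rw [hK]; ring
          have x2 : d₁ * u (i + 1) = J i + (d₁ + q₁) * u i := by rw [hJ]; ring
          have t1 : 0 ≤ (d₂ - d₁) * (J i * K i) :=
            mul_nonneg (by linarith) (mul_nonneg_of_nonpos_of_nonpos a hk.le)
          have t2 : 0 ≤ (q₂ * d₁ - q₁ * d₂) * (- J i * v i) :=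
            mul_nonneg (by linarith) (mul_nonneg (by linarith) pv.le)
          have t3 : 0 ≤ (d₁ * d₂ + q₁ * d₂) * (K i * u i - J i * v i) :=
            mul_nonneg (by positivity) (by linarith)
          have fin : d₁ * d₂ * (J i * v (i + 1)) ≤ d₁ * d₂ * (K i * u (i + 1)) := by
            have y1 : d₁ * d₂ * (J i * v (i + 1)) = d₁ * J i * (K i + (d₂ + q₂) * v i) := by
              rw [← x1]; ring
            have y2 : d₁ * d₂ * (K i * u (i + 1)) = d₂ * K i * (J i + (d₁ + q₁) * u i) := by
              rw [← x2]; ring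
            rw [y1, y2]; nlinarith
          exact le_of_mul_le_mul_left fin (by positivity)
      have h2 : J (i + 1) * v (i + 1) ≤ K (i + 1) * u (i + 1) := by
        have a : J (i + 1) = J i - u (i + 1) * (r - u (i + 1) - v (i + 1)) := by linarith
        have b : K (i + 1) = K i - v (i + 1) * (r - u (i + 1) - v (i + 1)) := by linarith
        rw [a, b]; linarith
      refine ⟨?_, h2⟩
      by_contra hc
      push Not at hc
      have f : r - u (i + 1) - v (i + 1) < 0 := by
        by_contra hf
        push Not at hf
        linarith [mul_nonneg pu'.le hf]
      have hk : 0 < K (i + 1) := by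
        have := mul_pos hc pv'
        by_contra hk
        nlinarith
      exact run (i + 1) hi hc hk f
  have h := (main m le_rfl).2
  rw [hJ, hK, hu0, hv0] at h
  have := mul_pos (hu m le_rfl) (hv m le_rfl)
  nlinarith

theorem noeq (n : ℕ) (hn : 2 ≤ n) (r d₁ q₁ d₂ q₂ : ℝ)
    (hd1 : 0 < d₁) (hq1 : 0 < q₁) (hq2 : 0 < q₂)
    (hd : d₁ ≤ d₂) (hq : q₁ * d₂ ≤ q₂ * d₁) (hs : d₁ + q₁ < d₂ + q₂)
    (uh vh : Fin n → ℝ) (hu : ∀ i, 0 < uh i) (hv : ∀ i, 0 < vh i)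
    (eu : ∀ i, (∑ j, (d₁ * Db n i j + q₁ * Qm n i j) * uh j) + uh i * (r - uh i - vh i) = 0)
    (ev : ∀ i, (∑ j, (d₂ * Db n i j + q₂ * Qm n i j) * vh j) + vh i * (r - uh i - vh i) = 0) :
    False := by
  obtain ⟨U, hU, hU0⟩ : ∃ U : ℕ → ℝ, (∀ j : Fin n, uh j = U j) ∧ U n = 0 :=
    ⟨fun k => if h : k < n then uh ⟨k, h⟩ else 0, fun j => by simp, by simp⟩
  obtain ⟨V, hV, hV0⟩ : ∃ V : ℕ → ℝ, (∀ j : Fin n, vh j = V j) ∧ V n = 0 :=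
    ⟨fun k => if h : k < n then vh ⟨k, h⟩ else 0, fun j => by simp, by simp⟩
  simp only [hU, hV] at hu hv eu ev
  obtain ⟨m, rfl⟩ : ∃ m, n = m + 1 := ⟨n - 1, by omega⟩
  refine core_s19 m r d₁ q₁ d₂ q₂ hd1 hq1 hq2 hd hq hs U V _ _
    (fun i hi => hu ⟨i, by omega⟩) (fun i hi => hv ⟨i, by omega⟩) hU0 hV0
    (fun _ => rfl) (fun _ => rfl) ?_ ?_ ?_ ?_
  · have := eu ⟨0, by omega⟩
    rwa [rowsum_zero _ _ _ _ hU0] at this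
  · have := ev ⟨0, by omega⟩
    rwa [rowsum_zero _ _ _ _ hV0] at this
  · intro i hi
    have := eu ⟨i + 1, by omega⟩
    rwa [rowsum_succ _ _ _ _ hU0] at this
  · intro i hi
    have := ev ⟨i + 1, by omega⟩
    rwa [rowsum_succ _ _ _ _ hV0] at this

/-- in case (b), under H2* and `(d₂,q₂) ∈ G₁* ∪ G₂*`, the two-species
competition model has no positive equilibrium. -/
theorem stmt_19 (n : ℕ) (hn : 2 ≤ n) (r d₁ q₁ d₂ q₂ : ℝ)
    (hr : 0 < r) (hd1 : 0 < d₁) (hq1 : 0 < q₁) (hd2 : 0 < d₂) (hq2 : 0 < q₂)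
    (H2s : ∃ lam : ℝ, 0 < lam ∧ ∃ w : Fin n → ℝ, (∀ i, 0 < w i) ∧
      (d₁ • Db n + q₁ • Qm n + Matrix.diagonal (fun _ : Fin n => r)).mulVec w = lam • w)
    (hG : (d₁ < d₂ ∧ d₂ ≤ d₁ / q₁ * q₂ ∧ (d₂, q₂) ≠ (d₁, q₁)) ∨
          (d₁ / q₁ * q₂ ≤ d₂ ∧ d₂ ≤ d₁ ∧ (d₂, q₂) ≠ (d₁, q₁))) :
    ¬ ∃ (uh vh : Fin n → ℝ), (∀ i, 0 < uh i) ∧ (∀ i, 0 < vh i) ∧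
      (∀ i, (∑ j, (d₁ * Db n i j + q₁ * Qm n i j) * uh j)
        + uh i * (r - uh i - vh i) = 0) ∧
      (∀ i, (∑ j, (d₂ * Db n i j + q₂ * Qm n i j) * vh j)
        + vh i * (r - uh i - vh i) = 0) := by
  rintro ⟨uh, vh, hu, hv, eu, ev⟩
  rcases hG with ⟨h1, h2, -⟩ | ⟨h1, h2, h3⟩
  · have hq : q₁ * d₂ ≤ q₂ * d₁ := by
      have := mul_le_mul_of_nonneg_left h2 hq1.le
      have e : q₁ * (d₁ / q₁ * q₂) = q₂ * d₁ := by field_simp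
      linarith
    have hs : d₁ + q₁ < d₂ + q₂ := by
      have : q₁ ≤ q₂ := by
        by_contra hc
        push Not at hc
        nlinarith [mul_lt_mul_of_pos_right hc hd1, mul_lt_mul_of_pos_left h1 hq1]
      linarith
    exact noeq n hn r d₁ q₁ d₂ q₂ hd1 hq1 hq2 h1.le hq hs uh vh hu hv eu ev
  · have hq : q₂ * d₁ ≤ q₁ * d₂ := by
      have := mul_le_mul_of_nonneg_left h1 hq1.le
      have e : q₁ * (d₁ / q₁ * q₂) = q₂ * d₁ := by field_simp
      linarith
    have hs : d₂ + q₂ < d₁ + q₁ := by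
      have hq' : q₂ ≤ q₁ := by
        by_contra hc
        push Not at hc
        nlinarith [mul_lt_mul_of_pos_right hc hd1, mul_le_mul_of_nonneg_left h2 hq1.le]
      rcases h2.lt_or_eq with h | h
      · linarith
      · rcases hq'.lt_or_eq with h' | h'
        · linarith
        · exact absurd (by rw [h, h']) h3
    refine noeq n hn r d₂ q₂ d₁ q₁ hd2 hq2 hq1 h2 hq hs vh uh hv hu ?_ ?_
    · intro i
      rw [← ev i]; ring
    · intro i
      rw [← eu i]; ring
end
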